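/- arXiv:1612.07048 — 4 statements merged into one kernel-verified Lean document; each statement's English description precedes it below -/
import Mathlib

section
/- Let S ⊆ ℝ^n be a semialgebraic set and let K = conv(S) be its convex hull in ℝ^n. Then the closure of K is a spectrahedral shadow if and only if there exist a finitely generated reduced commutative ℝ-algebra A, elements a_1, …, a_n ∈ A, and a finite-dimensional ℝ-linear subspace U ⊆ A such that: (1) for every ξ ∈ S there exists an ℝ-algebra homomorphism ρ : A → ℝ with ρ(a_i) = ξ_i for i = 1, …, n; and (2) for every affine-linear polynomial f = c_0 + c_1x_1 + … + c_nx_n with real coefficients satisfying f(ξ) ≥ 0 for all ξ ∈ S, the element c_0·1 + c_1a_1 + … + c_na_n of A is a sum of squares of elements of U. -/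
/-- A set `K ⊆ ℝ^k` is a spectrahedral shadow if it is the feasible-region projection of a
symmetric linear matrix inequality. -/
def IsSpectrahedralShadow {k : ℕ} (K : Set (Fin k → ℝ)) : Prop :=
  ∃ (d m : ℕ), 0 < d ∧ ∃ (A : Matrix (Fin d) (Fin d) ℝ)
    (B : Fin k → Matrix (Fin d) (Fin d) ℝ) (C : Fin m → Matrix (Fin d) (Fin d) ℝ),
    A.IsSymm ∧ (∀ i, (B i).IsSymm) ∧ (∀ j, (C j).IsSymm) ∧
    K = {ξ | ∃ η : Fin m → ℝ, (A + ∑ i, ξ i • B i + ∑ j, η j • C j).PosSemidef}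

/-- A set `S ⊆ ℝ^n` is semialgebraic: a finite union of sets given by one polynomial
equation and finitely many strict polynomial inequalities. -/
def IsSemialgebraic {n : ℕ} (S : Set (Fin n → ℝ)) : Prop :=
  ∃ (r : ℕ) (p : Fin r → MvPolynomial (Fin n) ℝ) (s : Fin r → ℕ)
    (q : (i : Fin r) → Fin (s i) → MvPolynomial (Fin n) ℝ),
    S = ⋃ i, {ξ | MvPolynomial.eval ξ (p i) = 0 ∧ ∀ j, 0 < MvPolynomial.eval ξ (q i j)}

/-- `x` is a sum of squares of elements of the subspace `U`. -/
def IsSumOfSquaresFrom {A : Type*} [CommRing A] [Algebra ℝ A] (U : Submodule ℝ A) (x : A) :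
    Prop :=
  ∃ (s : ℕ) (u : Fin s → A), (∀ i, u i ∈ U) ∧ x = ∑ i, u i ^ 2

lemma gram_sum_smul {A ι κ : Type*} [CommRing A] [Algebra ℝ A] [Fintype ι] [Fintype κ]
    (H : κ → ι → ℝ) (u : ι → A) :
    ∑ i, ∑ j, (∑ k, H k i * H k j) • (u i * u j) = ∑ k, (∑ i, H k i • u i) ^ 2 := by
  have h : ∀ k, (∑ i, H k i • u i) ^ 2 = ∑ i, ∑ j, (H k i * H k j) • (u i * u j) := fun k => by
    rw [sq, Finset.sum_mul_sum]
    simp only [smul_mul_smul_comm]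
  simp only [h, Finset.sum_smul]
  rw [Finset.sum_comm (γ := κ)]
  exact Finset.sum_congr rfl fun i _ => Finset.sum_comm

lemma gram_sum_mul {ι κ : Type*} [Fintype ι] [Fintype κ] (H : κ → ι → ℝ) (u : ι → ℝ) :
    ∑ i, ∑ j, (∑ k, H k i * H k j) * (u i * u j) = ∑ k, (∑ i, H k i * u i) ^ 2 :=
  gram_sum_smul H u

lemma gram_sum_mul_eq_sum {ι κ : Type*} [Fintype ι] [Fintype κ] (H : κ → ι → ℝ)
    (Z : Matrix ι ι ℝ) :
    ∑ i, ∑ j, (∑ k, H k i * H k j) * Z i j = ∑ k, ∑ i, ∑ j, Z i j * (H k i * H k j) := by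
  simp only [Finset.sum_mul]
  rw [Finset.sum_comm (γ := κ)]
  refine Finset.sum_congr rfl fun i _ => ?_
  rw [Finset.sum_comm]
  simp only [mul_comm]

namespace Matrix.PosSemidef

lemma real_iff {ι : Type*} [Fintype ι] {M : Matrix ι ι ℝ} :
    M.PosSemidef ↔ (∀ i j, M i j = M j i) ∧
      ∀ v : ι → ℝ, 0 ≤ ∑ i, ∑ j, M i j * (v i * v j) := by
  have key : ∀ v : ι → ℝ, star v ⬝ᵥ (M.mulVec v) = ∑ i, ∑ j, M i j * (v i * v j) := by
    intro v
    simp only [dotProduct, Matrix.mulVec, Finset.mul_sum, Pi.star_apply, star_trivial]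
    refine Finset.sum_congr rfl fun i _ => Finset.sum_congr rfl fun j _ => by ring
  rw [Matrix.posSemidef_iff_dotProduct_mulVec, Matrix.IsHermitian]
  simp only [key]
  refine and_congr_left fun _ => ⟨fun h i j => ?_, fun h => ?_⟩
  · conv_lhs => rw [← h]
    simp
  · ext i j
    simp [h i j]

open scoped MatrixOrder in
lemma exists_eq_gram {ι : Type*} [Fintype ι] {M : Matrix ι ι ℝ} (hM : M.PosSemidef) :
    ∃ H : ι → ι → ℝ, ∀ i j, M i j = ∑ k, H k i * H k j := by
  classical
  obtain ⟨H, hH⟩ := CStarAlgebra.nonneg_iff_eq_star_mul_self.mp hM.nonneg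
  refine ⟨H, fun i j => ?_⟩
  rw [hH]
  simp [Matrix.mul_apply, Matrix.star_apply]

lemma gram {ι κ : Type*} [Fintype ι] [Fintype κ] (H : κ → ι → ℝ) :
    (Matrix.of fun i j => ∑ k, H k i * H k j).PosSemidef :=
  real_iff.mpr ⟨fun i j => by simp [mul_comm], fun v => by
    simp only [Matrix.of_apply, gram_sum_mul]
    positivity⟩

lemma fromBlocks_diagonal_iff {ι κ : Type*} [Fintype ι] [Fintype κ] [DecidableEq κ]
    {X : Matrix ι ι ℝ} {d : κ → ℝ} :
    (Matrix.fromBlocks X 0 0 (Matrix.diagonal d)).PosSemidef ↔ X.PosSemidef ∧ 0 ≤ d := by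
  refine ⟨fun h => ⟨h.submatrix Sum.inl, ?_⟩, fun ⟨hX, hd⟩ => ?_⟩
  · exact Matrix.posSemidef_diagonal_iff.mp (h.submatrix Sum.inr)
  · have hD := Matrix.posSemidef_diagonal_iff.mpr hd
    rw [real_iff] at hX hD ⊢
    refine ⟨?_, fun v => ?_⟩
    · rintro (i | i) (j | j)
      · exact hX.1 i j
      · rfl
      · rfl
      · exact hD.1 i j
    · simp only [Fintype.sum_sum_type, Matrix.fromBlocks_apply₁₁, Matrix.fromBlocks_apply₁₂,
        Matrix.fromBlocks_apply₂₁, Matrix.fromBlocks_apply₂₂, Matrix.zero_apply, zero_mul,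
        Finset.sum_const_zero, add_zero, zero_add]
      exact add_nonneg (hX.2 fun i => v (Sum.inl i)) (hD.2 fun i => v (Sum.inr i))

lemma smul_one_add_symmetrization {ι : Type*} [Fintype ι] [DecidableEq ι] (Y : Matrix ι ι ℝ) :
    ((∑ i, ∑ j, |Y i j|) • (1 : Matrix ι ι ℝ) + (1 / 2 : ℝ) • (Y + Yᵀ)).PosSemidef := by
  refine real_iff.mpr ⟨fun i j => ?_, fun v => ?_⟩
  · simp [Matrix.one_apply, eq_comm, add_comm]
  · have h1 : ∑ i, ∑ j, ((∑ i, ∑ j, |Y i j|) • (1 : Matrix ι ι ℝ) +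
        (1 / 2 : ℝ) • (Y + Yᵀ)) i j * (v i * v j) =
        (∑ i, ∑ j, |Y i j|) * ∑ k, v k ^ 2 + ∑ i, ∑ j, Y i j * (v i * v j) := by
      have h2 : ∑ i, ∑ j, Y j i * (v i * v j) = ∑ i, ∑ j, Y i j * (v i * v j) := by
        rw [Finset.sum_comm]
        exact Finset.sum_congr rfl fun i _ => Finset.sum_congr rfl fun j _ => by ring
      have h3 : ∀ r : ℝ, ∑ i, ∑ j, (r * (1 : Matrix ι ι ℝ) i j) * (v i * v j)
          = r * ∑ k, v k ^ 2 := fun r => by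
        simp [Matrix.one_apply, Finset.mul_sum, sq]
      simp only [Matrix.add_apply, Matrix.smul_apply, smul_eq_mul, Matrix.transpose_apply, add_mul,
        Finset.sum_add_distrib, mul_add, h3]
      simp only [mul_assoc, ← Finset.mul_sum, h2]
      ring
    rw [h1, Finset.sum_mul, ← Finset.sum_add_distrib]
    refine Finset.sum_nonneg fun i _ => ?_
    rw [Finset.sum_mul, ← Finset.sum_add_distrib]
    refine Finset.sum_nonneg fun j _ => ?_
    have hi : v i ^ 2 ≤ ∑ k, v k ^ 2 :=
      Finset.single_le_sum (f := fun k => v k ^ 2) (fun k _ => sq_nonneg _) (Finset.mem_univ i)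
    have hj : v j ^ 2 ≤ ∑ k, v k ^ 2 :=
      Finset.single_le_sum (f := fun k => v k ^ 2) (fun k _ => sq_nonneg _) (Finset.mem_univ j)
    have hv : |v i * v j| ≤ ∑ k, v k ^ 2 := by
      rw [abs_le]
      constructor <;> nlinarith [sq_nonneg (v i + v j), sq_nonneg (v i - v j)]
    have h4 : |Y i j * (v i * v j)| ≤ |Y i j| * ∑ k, v k ^ 2 := by
      rw [abs_mul]
      gcongr
    linarith [neg_abs_le (Y i j * (v i * v j))]

end Matrix.PosSemidef

namespace IsSumOfSquaresFrom

variable {A : Type*} [CommRing A] [Algebra ℝ A] {U : Submodule ℝ A}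

lemma sum_sq {ι : Type*} [Fintype ι] {u : ι → A} (hu : ∀ i, u i ∈ U) :
    IsSumOfSquaresFrom U (∑ i, u i ^ 2) :=
  ⟨Fintype.card ι, fun k => u ((Fintype.equivFin ι).symm k), fun _ => hu _,
    (Equiv.sum_comp (Fintype.equivFin ι).symm fun i => u i ^ 2).symm⟩

lemma add {x y : A} (hx : IsSumOfSquaresFrom U x) (hy : IsSumOfSquaresFrom U y) :
    IsSumOfSquaresFrom U (x + y) := by
  obtain ⟨s, u, hu, rfl⟩ := hx
  obtain ⟨t, v, hv, rfl⟩ := hy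
  have h : ∀ i, Sum.elim u v i ∈ U := Sum.rec hu hv
  simpa [Fintype.sum_sum_type] using sum_sq h

lemma sum_gram {ι : Type*} [Fintype ι] {u : ι → A} (hu : ∀ i, u i ∈ U) {Y : Matrix ι ι ℝ}
    (hY : Y.PosSemidef) : IsSumOfSquaresFrom U (∑ i, ∑ j, Y i j • (u i * u j)) := by
  obtain ⟨H, hH⟩ := hY.exists_eq_gram
  simp only [hH, gram_sum_smul]
  exact sum_sq fun k => U.sum_mem fun i _ => U.smul_mem _ (hu i)

lemma nonneg_apply {X : Type*} {U : Submodule ℝ (X → ℝ)} {x : X → ℝ}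
    (hx : IsSumOfSquaresFrom U x) (p : X) : 0 ≤ x p := by
  obtain ⟨s, u, -, rfl⟩ := hx
  rw [Finset.sum_apply]
  exact Finset.sum_nonneg fun i _ => sq_nonneg (u i p)

lemma map_nonneg {x : A} (hx : IsSumOfSquaresFrom U x) (ρ : A →ₐ[ℝ] ℝ) : 0 ≤ ρ x := by
  obtain ⟨s, u, -, rfl⟩ := hx
  rw [map_sum]
  exact Finset.sum_nonneg fun i _ => by rw [map_pow]; exact sq_nonneg _

end IsSumOfSquaresFrom

/-- A cone of elements represented as sums of squares from a finite-dimensional subspace contains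
an element one of whose representations spans every other representation. -/
lemma exists_spanning_representation {L A : Type*} [AddCommGroup L] [Module ℝ L] [CommRing A]
    [Algebra ℝ A] (U : Submodule ℝ A) [FiniteDimensional ℝ U] (φ : L →ₗ[ℝ] A) (P : L → Prop)
    (hadd : ∀ f g, P f → P g → P (f + g)) (hne : ∃ f, P f)
    (hP : ∀ f, P f → IsSumOfSquaresFrom U (φ f)) :
    ∃ (s : ℕ) (u : Fin s → A) (f₀ : L), P f₀ ∧ (∀ i, u i ∈ U) ∧ φ f₀ = ∑ i, u i ^ 2 ∧
      ∀ f, P f → ∃ Y : Matrix (Fin s) (Fin s) ℝ, Y.PosSemidef ∧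
        φ f = ∑ i, ∑ j, Y i j • (u i * u j) := by
  let N : Set ℕ := {d | ∃ (s : ℕ) (u : Fin s → A) (f₀ : L), P f₀ ∧ (∀ i, u i ∈ U) ∧
    φ f₀ = ∑ i, u i ^ 2 ∧ d = Module.finrank ℝ (Submodule.span ℝ (Set.range u))}
  have hspan : ∀ {s : ℕ} {u : Fin s → A}, (∀ i, u i ∈ U) →
      Submodule.span ℝ (Set.range u) ≤ U := fun hu =>
    Submodule.span_le.mpr (Set.range_subset_iff.mpr hu)
  have hbdd : BddAbove N := by
    refine ⟨Module.finrank ℝ U, ?_⟩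
    rintro d ⟨s, u, f₀, -, hu, -, rfl⟩
    exact Submodule.finrank_mono (hspan hu)
  have hN : N.Nonempty := by
    obtain ⟨f, hf⟩ := hne
    obtain ⟨s, u, hu, hfu⟩ := hP f hf
    exact ⟨_, s, u, f, hf, hu, hfu, rfl⟩
  obtain ⟨s, u, f₀, hf₀, hu, hfu, hd⟩ := Nat.sSup_mem hN hbdd
  refine ⟨s, u, f₀, hf₀, hu, hfu, fun f hf => ?_⟩
  obtain ⟨t, v, hv, hfv⟩ := hP f hf
  have happ : ∀ i, Fin.append u v i ∈ U := fun i =>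
    Fin.addCases (fun i => by simpa using hu i) (fun i => by simpa using hv i) i
  have hmem : Module.finrank ℝ (Submodule.span ℝ (Set.range (Fin.append u v))) ∈ N :=
    ⟨s + t, Fin.append u v, f₀ + f, hadd _ _ hf₀ hf, happ, by
      simp [Fin.sum_univ_add, hfu, hfv], rfl⟩
  have hle : Submodule.span ℝ (Set.range u) ≤ Submodule.span ℝ (Set.range (Fin.append u v)) := by
    refine Submodule.span_mono ?_
    rintro _ ⟨i, rfl⟩
    exact ⟨Fin.castAdd t i, by simp⟩
  have hfd : FiniteDimensional ℝ (Submodule.span ℝ (Set.range (Fin.append u v))) :=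
    FiniteDimensional.span_of_finite ℝ (Set.finite_range _)
  have heq := Submodule.eq_of_le_of_finrank_le hle (hd ▸ le_csSup hbdd hmem)
  have hvs : ∀ k, ∃ c : Fin s → ℝ, ∑ i, c i • u i = v k := fun k => by
    rw [← Submodule.mem_span_range_iff_exists_fun, heq]
    exact Submodule.subset_span ⟨Fin.natAdd s k, by simp⟩
  choose c hc using hvs
  refine ⟨_, Matrix.PosSemidef.gram c, ?_⟩
  simp only [Matrix.of_apply, gram_sum_smul, hc, hfv]

/-- Conic duality for sums of squares: if `∑ u i ^ 2` lies in the image of `φ`, then functionals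
nonnegative on the elements mapped to sums of squares are represented by positive semidefinite
moment matrices. -/
lemma exists_posSemidef_moment_matrix {L A κ : Type*} [AddCommGroup L] [Module ℝ L] [CommRing A]
    [Algebra ℝ A] [Fintype κ] (φ : L →ₗ[ℝ] A) (u : κ → A) (f₀ : L) (hf₀ : φ f₀ = ∑ i, u i ^ 2)
    (ℓ : L →ₗ[ℝ] ℝ)
    (hℓ : ∀ f (G : Matrix κ κ ℝ), G.PosSemidef → φ f = ∑ i, ∑ j, G i j • (u i * u j) → 0 ≤ ℓ f) :
    ∃ Z : Matrix κ κ ℝ, Z.PosSemidef ∧ ∀ f (Y : Matrix κ κ ℝ),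
      φ f = ∑ i, ∑ j, Y i j • (u i * u j) → ℓ f = ∑ i, ∑ j, Y i j * Z i j := by
  classical
  let q : Matrix κ κ ℝ →ₗ[ℝ] A :=
    { toFun := fun Y => ∑ i, ∑ j, Y i j • (u i * u j)
      map_add' := fun X Y => by simp [add_smul, Finset.sum_add_distrib]
      map_smul' := fun r X => by simp [Finset.smul_sum, mul_smul] }
  have hq : ∀ Y, q Y = ∑ i, ∑ j, Y i j • (u i * u j) := fun _ => rfl
  simp only [← hq] at hℓ ⊢
  have hqT : ∀ Y : Matrix κ κ ℝ, q Y.transpose = q Y := fun Y => by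
    rw [hq, hq, Finset.sum_comm]
    simp [mul_comm]
  have hq1 : q 1 = ∑ i, u i ^ 2 := by
    simp [hq, Matrix.one_apply, sq, ite_smul]
  let C : PointedCone ℝ (L × Matrix κ κ ℝ) :=
    { carrier := {p | ∃ G : Matrix κ κ ℝ, G.PosSemidef ∧ φ p.1 + q p.2 = q G}
      add_mem' := by
        rintro a b ⟨G, hG, h⟩ ⟨G', hG', h'⟩
        refine ⟨G + G', hG.add hG', ?_⟩
        simp only [Prod.fst_add, Prod.snd_add, map_add, ← h, ← h']
        abel
      zero_mem' := ⟨0, Matrix.PosSemidef.zero, by simp⟩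
      smul_mem' := by
        rintro ⟨r, hr⟩ a ⟨G, hG, h⟩
        refine ⟨r • G, hG.smul hr, ?_⟩
        rw [map_smul, ← h, smul_add, ← map_smul, ← map_smul]
        rfl }
  have hC : ∀ p : L × Matrix κ κ ℝ, p ∈ C ↔
    ∃ G : Matrix κ κ ℝ, G.PosSemidef ∧ φ p.1 + q p.2 = q G := fun _ => Iff.rfl
  obtain ⟨g, hg, hgC⟩ := riesz_extension C
    ((ℓ.comp (LinearMap.fst ℝ L (Matrix κ κ ℝ))).toPMap (Submodule.prod ⊤ ⊥))
    (by
      rintro ⟨⟨f, Y⟩, hY⟩ ⟨G, hG, h⟩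
      have hY0 : Y = 0 := by simpa using hY
      subst hY0
      exact hℓ f G hG (by simpa using h))
    (by
      rintro ⟨f, Y⟩
      refine ⟨⟨(-f + (∑ i, ∑ j, |Y i j|) • f₀, 0), by simp⟩, _,
        Matrix.PosSemidef.smul_one_add_symmetrization Y, ?_⟩
      simp only [Prod.fst_add, Prod.snd_add, map_add, map_neg, map_smul, hf₀, hqT, hq1, zero_add]
      module)
  have hg0 : ∀ f, g (f, 0) = ℓ f := fun f => hg ⟨(f, 0), by simp⟩
  have hzero : ∀ f Y, φ f + q Y = 0 → g (f, Y) = 0 := fun f Y h => by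
    have h1 : 0 ≤ g (f, Y) := hgC _ ((hC _).mpr ⟨0, Matrix.PosSemidef.zero, by simpa using h⟩)
    have h2 : 0 ≤ g (-(f, Y)) := hgC _ ((hC _).mpr ⟨0, Matrix.PosSemidef.zero, by
      rw [Prod.fst_neg, Prod.snd_neg, map_neg, map_neg, map_zero, ← neg_add, h, neg_zero]⟩)
    rw [map_neg] at h2
    linarith
  have hgY : ∀ Y : Matrix κ κ ℝ, g (0, Y) = ∑ i, ∑ j, Y i j * g (0, Matrix.single i j 1) :=
    fun Y => by
      have h : g.comp (LinearMap.inr ℝ L (Matrix κ κ ℝ)) Y = _ := rfl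
      conv_rhs at h => rw [Matrix.matrix_eq_sum_single Y]
      simp only [map_sum] at h
      refine h.trans (Finset.sum_congr rfl fun i _ => Finset.sum_congr rfl fun j _ => ?_)
      rw [← smul_eq_mul, ← map_smul, Prod.smul_mk, smul_zero, Matrix.smul_single, smul_eq_mul,
        mul_one]
      rfl
  refine ⟨Matrix.of fun i j => g (0, Matrix.single i j 1), ?_, fun f Y hfY => ?_⟩
  · refine Matrix.PosSemidef.real_iff.mpr ⟨fun i j => ?_, fun v => ?_⟩
    · have h := hzero 0 (Matrix.single i j 1 - (Matrix.single i j 1).transpose) (by rw [map_zero, map_sub, hqT, sub_self, add_zero])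
      have h' : ((0 : L), Matrix.single i j (1 : ℝ) - (Matrix.single i j 1).transpose) =
          (0, Matrix.single i j 1) - (0, Matrix.single j i 1) := by simp
      rw [h', map_sub, sub_eq_zero] at h
      exact h
    · have h := hgC (0, Matrix.of fun i j => ∑ _k : Unit, v i * v j)
        ((hC _).mpr ⟨_, Matrix.PosSemidef.gram fun _ : Unit => v, by simp⟩)
      rw [hgY] at h
      simpa [mul_comm] using h
  · have h := hzero f (-Y) (by rw [map_neg, hfY, add_neg_cancel])
    have h' : (f, -Y) = (f, (0 : Matrix κ κ ℝ)) - (0, Y) := by simp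
    rw [h', map_sub, hg0, hgY, sub_eq_zero] at h
    exact h

lemma isSpectrahedralShadow_of_linearMap {n : ℕ} {W ι : Type*} [AddCommGroup W] [Module ℝ W]
    [FiniteDimensional ℝ W] [Fintype ι] [Nonempty ι] (A : Matrix ι ι ℝ)
    (B : (Fin n → ℝ) →ₗ[ℝ] Matrix ι ι ℝ) (C : W →ₗ[ℝ] Matrix ι ι ℝ)
    (hA : A.IsSymm) (hB : ∀ ξ, (B ξ).IsSymm) (hC : ∀ w, (C w).IsSymm) :
    IsSpectrahedralShadow {ξ | ∃ w, (A + B ξ + C w).PosSemidef} := by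
  classical
  let e := Fintype.equivFin ι
  let b := Module.finBasis ℝ W
  refine ⟨Fintype.card ι, Module.finrank ℝ W, Fintype.card_pos,
    A.submatrix e.symm e.symm, fun i => (B fun j => if i = j then 1 else 0).submatrix e.symm e.symm,
    fun j => (C (b j)).submatrix e.symm e.symm, hA.submatrix _, fun i => (hB _).submatrix _,
    fun j => (hC _).submatrix _, ?_⟩
  have key : ∀ ξ w, A.submatrix e.symm e.symm +
      ∑ i, ξ i • (B fun j => if i = j then 1 else 0).submatrix e.symm e.symm +
      ∑ j, b.equivFun w j • (C (b j)).submatrix e.symm e.symm =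
      (A + B ξ + C w).submatrix e.symm e.symm := fun ξ w => by
    have hw : C w = ∑ j, b.equivFun w j • C (b j) := by
      conv_lhs => rw [← b.sum_equivFun w, map_sum]
      simp only [map_smul]
    rw [B.pi_apply_eq_sum_univ ξ, hw]
    ext i j
    simp [Matrix.sum_apply]
  ext ξ
  constructor
  · rintro ⟨w, hw⟩
    refine ⟨b.equivFun w, ?_⟩
    rw [key]
    exact hw.submatrix _
  · rintro ⟨η, hη⟩
    refine ⟨b.equivFun.symm η, ?_⟩
    have h := key ξ (b.equivFun.symm η)
    rw [LinearEquiv.apply_symm_apply] at h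
    rw [h] at hη
    exact (Matrix.posSemidef_submatrix_equiv e.symm).mp hη

lemma isSpectrahedralShadow_of_slice {n : ℕ} {W ι : Type*} [AddCommGroup W] [Module ℝ W]
    [FiniteDimensional ℝ W] [Fintype ι] (π : W →ₗ[ℝ] (Fin n → ℝ)) (τ : W →ₗ[ℝ] ℝ)
    (Z : W →ₗ[ℝ] Matrix ι ι ℝ) (hZ : ∀ w, (Z w).IsSymm) :
    IsSpectrahedralShadow {ξ | ∃ w, π w = ξ ∧ τ w = 1 ∧ (Z w).PosSemidef} := by
  classical
  let κ := Option (Fin n)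
  let E : (κ → ℝ) →ₗ[ℝ] Matrix (ι ⊕ (κ ⊕ κ)) (ι ⊕ (κ ⊕ κ)) ℝ :=
    { toFun := fun h => Matrix.fromBlocks 0 0 0 (Matrix.diagonal (Sum.elim h (-h)))
      map_add' := fun g h => by
        rw [Matrix.fromBlocks_add, Matrix.diagonal_add]
        congr <;> try simp
        ext (k | k) <;> simp [add_comm]
      map_smul' := fun r h => by
        rw [RingHom.id_apply, Matrix.fromBlocks_smul, ← Matrix.diagonal_smul]
        congr <;> try simp
        ext (k | k) <;> simp }
  let F : W →ₗ[ℝ] Matrix (ι ⊕ (κ ⊕ κ)) (ι ⊕ (κ ⊕ κ)) ℝ :=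
    { toFun := fun w => Matrix.fromBlocks (Z w) 0 0 0
      map_add' := fun v w => by simp [Matrix.fromBlocks_add]
      map_smul' := fun r w => by simp [Matrix.fromBlocks_smul] }
  let α : (Fin n → ℝ) →ₗ[ℝ] (κ → ℝ) :=
    { toFun := fun ξ k => k.elim 0 fun i => -ξ i
      map_add' := fun v w => by ext (_ | i) <;> simp [add_comm]
      map_smul' := fun r w => by ext (_ | i) <;> simp }
  let γ : W →ₗ[ℝ] (κ → ℝ) :=
    { toFun := fun w k => k.elim (τ w) (π w)
      map_add' := fun v w => by ext (_ | i) <;> simp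
      map_smul' := fun r w => by ext (_ | i) <;> simp }
  have hE : ∀ h, (E h).IsSymm := fun h =>
    Matrix.IsSymm.fromBlocks Matrix.isSymm_zero (by simp) (Matrix.isSymm_diagonal _)
  have hF : ∀ w, (F w).IsSymm := fun w =>
    Matrix.IsSymm.fromBlocks (hZ w) (by simp) Matrix.isSymm_zero
  convert isSpectrahedralShadow_of_linearMap (E fun k => k.elim (-1) 0) (E ∘ₗ α) (F + E ∘ₗ γ)
    (hE _) (fun _ => hE _) (fun w => (hF w).add (hE _)) using 5 with ξ w
  have key : E (fun k => k.elim (-1) 0) + (E ∘ₗ α) ξ + (F + E ∘ₗ γ) w =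
      Matrix.fromBlocks (Z w) 0 0 (Matrix.diagonal
        (Sum.elim (fun k => k.elim (τ w - 1) fun i => π w i - ξ i)
          (-fun k => k.elim (τ w - 1) fun i => π w i - ξ i))) := by
    have h : (fun k : κ => k.elim (τ w - 1) fun i => π w i - ξ i) =
        (fun k => k.elim (-1) 0) + α ξ + γ w := by
      ext (_ | i) <;> simp [α, γ] <;> ring
    rw [h]
    have h' : ∀ g : κ → ℝ, Matrix.fromBlocks (Z w) 0 0 (Matrix.diagonal (Sum.elim g (-g))) =
        F w + E g := fun g => by simp [E, F, Matrix.fromBlocks_add]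
    rw [h', map_add, map_add]
    simp only [LinearMap.comp_apply, LinearMap.add_apply]
    abel
  rw [key, Matrix.PosSemidef.fromBlocks_diagonal_iff]
  constructor
  · rintro ⟨rfl, h1, h⟩
    refine ⟨h, ?_⟩
    rintro ((_ | i) | (_ | i)) <;> simp [h1]
  · rintro ⟨h, hd⟩
    refine ⟨funext fun i => ?_, ?_, h⟩
    · have h1 := hd (Sum.inl (some i))
      have h2 := hd (Sum.inr (some i))
      simp at h1 h2
      linarith
    · have h1 := hd (Sum.inl none)
      have h2 := hd (Sum.inr none)
      simp at h1 h2
      linarith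

lemma affine_nonneg_of_mem_closure_convexHull {n : ℕ} {S : Set (Fin n → ℝ)} {c₀ : ℝ}
    {c : Fin n → ℝ} (h : ∀ ξ ∈ S, 0 ≤ c₀ + ∑ i, c i * ξ i) :
    ∀ ξ ∈ closure (convexHull ℝ S), 0 ≤ c₀ + ∑ i, c i * ξ i := by
  have hclosed : IsClosed {ξ : Fin n → ℝ | 0 ≤ c₀ + ∑ i, c i * ξ i} :=
    isClosed_le continuous_const (by fun_prop)
  have hconv : Convex ℝ {ξ : Fin n → ℝ | 0 ≤ c₀ + ∑ i, c i * ξ i} := by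
    intro x hx y hy a b ha hb hab
    simp only [Set.mem_ofPred_eq] at hx hy ⊢
    have key : c₀ + ∑ i, c i * (a • x + b • y) i =
        a * (c₀ + ∑ i, c i * x i) + b * (c₀ + ∑ i, c i * y i) := by
      simp only [Pi.add_apply, Pi.smul_apply, smul_eq_mul, mul_add, Finset.sum_add_distrib,
        Finset.mul_sum]
      have hc : c₀ = a * c₀ + b * c₀ := by rw [← add_mul, hab, one_mul]
      conv_lhs => rw [hc]
      simp only [mul_left_comm (c _)]
      ring
    rw [key]
    positivity
  exact closure_minimal (convexHull_min h hconv) hclosed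

lemma mem_closure_convexHull_of_affine_nonneg {n : ℕ} {S : Set (Fin n → ℝ)} {ξ : Fin n → ℝ}
    (h : ∀ (c₀ : ℝ) (c : Fin n → ℝ), (∀ ζ ∈ S, 0 ≤ c₀ + ∑ i, c i * ζ i) →
      0 ≤ c₀ + ∑ i, c i * ξ i) : ξ ∈ closure (convexHull ℝ S) := by
  classical
  by_contra hξ
  obtain ⟨f, u, hu, huξ⟩ := geometric_hahn_banach_closed_point
    (convex_convexHull ℝ S).closure isClosed_closure hξ
  have hf : ∀ x : Fin n → ℝ, u + ∑ i, -(f fun j => if i = j then 1 else 0) * x i = u - f x :=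
    fun x => by
      have h := f.toLinearMap.pi_apply_eq_sum_univ x
      simp only [ContinuousLinearMap.coe_coe, smul_eq_mul] at h
      simp [h, mul_comm, sub_eq_add_neg]
  have h1 := h u (fun i => -(f fun j => if i = j then 1 else 0)) fun ζ hζ => by
    rw [hf]
    linarith [hu ζ (subset_closure (subset_convexHull ℝ S hζ))]
  rw [hf] at h1
  linarith

lemma isSpectrahedralShadow_of_sumOfSquares {n : ℕ} {S : Set (Fin n → ℝ)} {A : Type*} [CommRing A]
    [Algebra ℝ A] (a : Fin n → A) (U : Submodule ℝ A) [FiniteDimensional ℝ U]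
    (hS : ∀ ξ ∈ S, ∃ ρ : A →ₐ[ℝ] ℝ, ∀ i, ρ (a i) = ξ i)
    (hU : ∀ (c₀ : ℝ) (c : Fin n → ℝ), (∀ ξ ∈ S, 0 ≤ c₀ + ∑ i, c i * ξ i) →
      IsSumOfSquaresFrom U (algebraMap ℝ A c₀ + ∑ i, c i • a i)) :
    IsSpectrahedralShadow (closure (convexHull ℝ S)) := by
  let φ : ℝ × (Fin n → ℝ) →ₗ[ℝ] A :=
    (Algebra.linearMap ℝ A).coprod (Fintype.linearCombination ℝ a)
  have hφ : ∀ c₀ c, φ (c₀, c) = algebraMap ℝ A c₀ + ∑ i, c i • a i := fun _ _ => by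
    simp [φ, Fintype.linearCombination_apply]
  let P : ℝ × (Fin n → ℝ) → Prop := fun f => ∀ ξ ∈ S, 0 ≤ f.1 + ∑ i, f.2 i * ξ i
  obtain ⟨s, u, f₀, hf₀, hu, hfu, hY⟩ := exists_spanning_representation U φ P
    (fun f g hf hg ξ hξ => by
      have h := add_nonneg (hf ξ hξ) (hg ξ hξ)
      simp only [Prod.fst_add, Prod.snd_add, Pi.add_apply, add_mul, Finset.sum_add_distrib]
      linarith)
    ⟨0, fun ξ _ => by simp⟩ (fun f hf => hU f.1 f.2 hf)
  let W : Submodule ℝ ((ℝ × (Fin n → ℝ)) × Matrix (Fin s) (Fin s) ℝ) :=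
    { carrier := {p | p.2.IsSymm ∧ ∀ (c₀ : ℝ) (c : Fin n → ℝ) (Y : Matrix (Fin s) (Fin s) ℝ),
        φ (c₀, c) = ∑ i, ∑ j, Y i j • (u i * u j) →
        c₀ * p.1.1 + ∑ i, c i * p.1.2 i = ∑ i, ∑ j, Y i j * p.2 i j}
      add_mem' := by
        rintro p q ⟨hp, hp'⟩ ⟨hq, hq'⟩
        refine ⟨hp.add hq, fun c₀ c Y h => ?_⟩
        have h1 := hp' c₀ c Y h
        have h2 := hq' c₀ c Y h
        simp only [Prod.fst_add, Prod.snd_add, Pi.add_apply, Matrix.add_apply, mul_add,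
          Finset.sum_add_distrib]
        linarith
      zero_mem' := ⟨Matrix.isSymm_zero, fun c₀ c Y h => by simp⟩
      smul_mem' := by
        rintro r p ⟨hp, hp'⟩
        refine ⟨hp.smul r, fun c₀ c Y h => ?_⟩
        have h1 := hp' c₀ c Y h
        simp only [Prod.smul_fst, Prod.smul_snd, Pi.smul_apply, Matrix.smul_apply, smul_eq_mul,
          mul_left_comm _ r, ← Finset.mul_sum, ← mul_add, h1] }
  let ν : W →ₗ[ℝ] ℝ × (Fin n → ℝ) := LinearMap.fst ℝ _ _ ∘ₗ W.subtype
  convert isSpectrahedralShadow_of_slice (LinearMap.snd ℝ _ _ ∘ₗ ν) (LinearMap.fst ℝ _ _ ∘ₗ ν)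
    (LinearMap.snd ℝ _ _ ∘ₗ W.subtype) (fun w => w.2.1) using 1
  ext ξ
  constructor
  · intro hξ
    let ℓ : ℝ × (Fin n → ℝ) →ₗ[ℝ] ℝ := LinearMap.coprod LinearMap.id (Fintype.linearCombination ℝ ξ)
    have hℓ : ∀ f, ℓ f = f.1 + ∑ i, f.2 i * ξ i := fun f => by
      simp [ℓ, Fintype.linearCombination_apply]
    obtain ⟨Z, hZ, hYZ⟩ := exists_posSemidef_moment_matrix φ u f₀ hfu ℓ fun f G hG hfG => by
      rw [hℓ]
      refine affine_nonneg_of_mem_closure_convexHull (fun ζ hζ => ?_) ξ hξ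
      obtain ⟨ρ, hρ⟩ := hS ζ hζ
      have h := (IsSumOfSquaresFrom.sum_gram hu hG).map_nonneg ρ
      rw [← hfG, ← Prod.mk.eta (p := f), hφ] at h
      simpa [hρ] using h
    refine ⟨⟨((1, ξ), Z), hZ.1, fun c₀ c Y h => ?_⟩, rfl, rfl, hZ⟩
    rw [← hYZ _ Y h, hℓ, mul_one]
  · rintro ⟨⟨⟨⟨c₁, ξ'⟩, Z⟩, hZ, hrel⟩, rfl, h1, hpos⟩
    obtain rfl : c₁ = 1 := h1
    refine mem_closure_convexHull_of_affine_nonneg fun c₀ c hc => ?_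
    obtain ⟨Y, hYpos, hYeq⟩ := hY (c₀, c) hc
    have h := hrel c₀ c Y hYeq
    rw [mul_one] at h
    refine h.symm ▸ ?_
    obtain ⟨H, hH⟩ := hYpos.exists_eq_gram
    have hq := (Matrix.PosSemidef.real_iff.mp hpos).2
    have key : ∑ i, ∑ j, Y i j * Z i j = ∑ k, ∑ i, ∑ j, Z i j * (H k i * H k j) := by
      simp only [hH, gram_sum_mul_eq_sum]
    rw [key]
    exact Finset.sum_nonneg fun k _ => hq (H k)

/-- Exact duality over a spectrahedral shadow: affine functions nonnegative on it are traces against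
a fixed family of positive semidefinite matrices. -/
lemma exists_gram_representation {n d m : ℕ} (A : Matrix (Fin d) (Fin d) ℝ)
    (B : Fin n → Matrix (Fin d) (Fin d) ℝ) (C : Fin m → Matrix (Fin d) (Fin d) ℝ)
    (hA : A.IsSymm) (hB : ∀ i, (B i).IsSymm) (hC : ∀ j, (C j).IsSymm) {Q : Set (Fin n → ℝ)}
    (hQ : Q = {ξ | ∃ η : Fin m → ℝ, (A + ∑ i, ξ i • B i + ∑ j, η j • C j).PosSemidef}) :
    ∃ (s : ℕ) (Y : (Fin n → ℝ) → Matrix (Fin s) (Fin s) ℝ), (∀ ξ ∈ Q, (Y ξ).PosSemidef) ∧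
      ∀ (c₀ : ℝ) (c : Fin n → ℝ), (∀ ξ ∈ Q, 0 ≤ c₀ + ∑ i, c i * ξ i) →
        ∃ Z : Matrix (Fin s) (Fin s) ℝ, Z.PosSemidef ∧
          ∀ ξ ∈ Q, c₀ + ∑ i, c i * ξ i = ∑ i, ∑ j, Y ξ i j * Z i j := by
  obtain rfl | ⟨ξ₀, hξ₀⟩ := Q.eq_empty_or_nonempty
  · exact ⟨0, fun _ => 0, by simp, fun _ _ _ => ⟨0, Matrix.PosSemidef.zero, by simp⟩⟩
  let M : ℝ × (Fin n → ℝ) × (Fin m → ℝ) →ₗ[ℝ] Matrix (Fin d) (Fin d) ℝ :=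
    (LinearMap.toSpanSingleton ℝ _ A).coprod
      ((Fintype.linearCombination ℝ B).coprod (Fintype.linearCombination ℝ C))
  have hM : ∀ w, M w = w.1 • A + ∑ i, w.2.1 i • B i + ∑ j, w.2.2 j • C j := fun w => by
    simp [M, Fintype.linearCombination_apply, add_assoc]
  have hMsymm : ∀ w i j, M w i j = M w j i := fun w i j => by
    simp [hM, Matrix.sum_apply, hA.apply i j, (hB _).apply i j, (hC _).apply i j]
  replace hQ : ∀ ξ, ξ ∈ Q ↔ ∃ η, (M (1, ξ, η)).PosSemidef := fun ξ => by simp [hM, hQ]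
  let φ : ℝ × (Fin n → ℝ) × (Fin m → ℝ) →ₗ[ℝ] ((Fin d → ℝ) × ℝ → ℝ) :=
    { toFun := fun w x => ∑ i, ∑ j, M w i j * (x.1 i * x.1 j) + w.1 * x.2 ^ 2
      map_add' := fun v w => by
        ext x
        simp only [map_add, Matrix.add_apply, add_mul, Finset.sum_add_distrib, Prod.fst_add,
          Pi.add_apply]
        ring
      map_smul' := fun r w => by
        ext x
        simp only [map_smul, Matrix.smul_apply, smul_eq_mul, mul_assoc, ← Finset.mul_sum,
          Prod.smul_fst, Pi.smul_apply, RingHom.id_apply]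
        ring }
  have hφ : ∀ w x, φ w x = ∑ i, ∑ j, M w i j * (x.1 i * x.1 j) + w.1 * x.2 ^ 2 := fun _ _ => rfl
  let p : Option (Fin d) → (Fin d → ℝ) × ℝ → ℝ := fun k x => k.elim x.2 x.1
  let U : Submodule ℝ ((Fin d → ℝ) × ℝ → ℝ) := Submodule.span ℝ (Set.range p)
  have hU : FiniteDimensional ℝ U := FiniteDimensional.span_of_finite ℝ (Set.finite_range p)
  have hp : ∀ k, p k ∈ U := fun k => Submodule.subset_span ⟨k, rfl⟩
  have hsos : ∀ w, 0 ≤ w.1 → (M w).PosSemidef → IsSumOfSquaresFrom U (φ w) := fun w hw hMw => by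
    have h1 := IsSumOfSquaresFrom.sum_gram (fun i => hp (some i)) hMw
    have h2 := IsSumOfSquaresFrom.sum_sq (U := U) (u := fun _ : Unit => √w.1 • p none)
      fun _ => U.smul_mem _ (hp _)
    convert h1.add h2 using 1
    ext x
    simp [hφ, p, mul_pow, Real.sq_sqrt hw]
  have hpos : ∀ w, IsSumOfSquaresFrom U (φ w) → 0 ≤ w.1 ∧ (M w).PosSemidef := fun w hw =>
    ⟨by simpa [hφ] using hw.nonneg_apply (0, 1),
      Matrix.PosSemidef.real_iff.mpr ⟨hMsymm w, fun v => by
        simpa [hφ] using hw.nonneg_apply (v, 0)⟩⟩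
  obtain ⟨η₀, hη₀⟩ := (hQ ξ₀).mp hξ₀
  obtain ⟨s, u, f₀, hf₀, hu, hfu, hY⟩ := exists_spanning_representation U φ
    (fun w => 0 < w.1 ∧ (M w).PosSemidef)
    (fun v w hv hw => ⟨add_pos hv.1 hw.1, by rw [map_add]; exact hv.2.add hw.2⟩)
    ⟨(1, ξ₀, η₀), one_pos, hη₀⟩ (fun w hw => hsos w hw.1.le hw.2)
  have hex : ∀ ξ : Q, ∃ (η : Fin m → ℝ) (Y : Matrix (Fin s) (Fin s) ℝ), Y.PosSemidef ∧
      φ (1, ξ, η) = ∑ i, ∑ j, Y i j • (u i * u j) := fun ξ => by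
    obtain ⟨η, hη⟩ := (hQ ξ).mp ξ.2
    exact ⟨η, hY _ ⟨one_pos, hη⟩⟩
  choose η Y hYpos hYeq using hex
  classical
  refine ⟨s, fun ξ => if h : ξ ∈ Q then Y ⟨ξ, h⟩ else 0, fun ξ hξ => ?_, fun c₀ c hc => ?_⟩
  · simpa [hξ] using hYpos ⟨ξ, hξ⟩
  let ℓ : ℝ × (Fin n → ℝ) × (Fin m → ℝ) →ₗ[ℝ] ℝ :=
    (LinearMap.toSpanSingleton ℝ ℝ c₀).coprod
      ((Fintype.linearCombination ℝ c).comp (LinearMap.fst ℝ _ _))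
  have hℓ : ∀ w, ℓ w = w.1 * c₀ + ∑ i, c i * w.2.1 i := fun w => by
    simp [ℓ, Fintype.linearCombination_apply, mul_comm]
  have hℓpos : ∀ w, 0 < w.1 → (M w).PosSemidef → 0 ≤ ℓ w := fun w hw hMw => by
    have h1 : w = w.1 • (1, w.1⁻¹ • w.2.1, w.1⁻¹ • w.2.2) := by
      ext <;> simp [hw.ne']
    have h2 : w.1⁻¹ • w = (1, w.1⁻¹ • w.2.1, w.1⁻¹ • w.2.2) := by
      ext <;> simp [hw.ne']
    have h3 := hc (w.1⁻¹ • w.2.1) ((hQ _).mpr ⟨w.1⁻¹ • w.2.2, by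
      rw [← h2, map_smul]
      exact hMw.smul (inv_nonneg.mpr hw.le)⟩)
    rw [h1, map_smul, hℓ]
    simpa using mul_nonneg hw.le h3
  obtain ⟨Z, hZ, hYZ⟩ := exists_posSemidef_moment_matrix φ u f₀ hfu ℓ fun f G hG hfG => by
    obtain ⟨hf1, hf2⟩ := hpos f (hfG ▸ IsSumOfSquaresFrom.sum_gram hu hG)
    have hε : ∀ ε : ℝ, 0 < ε → 0 ≤ ℓ f + ε * ℓ f₀ := fun ε hε => by
      have h := hℓpos (f + ε • f₀)
        (add_pos_of_nonneg_of_pos hf1 (mul_pos hε hf₀.1))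
        (by rw [map_add, map_smul]; exact hf2.add (hf₀.2.smul hε.le))
      simpa using h
    have hlim : Filter.Tendsto (fun ε : ℝ => ℓ f + ε * ℓ f₀) (nhdsWithin 0 (Set.Ioi 0))
        (nhds (ℓ f)) := by
      have h : Continuous fun ε : ℝ => ℓ f + ε * ℓ f₀ := by fun_prop
      simpa using (h.tendsto 0).mono_left nhdsWithin_le_nhds
    exact ge_of_tendsto hlim (eventually_mem_nhdsWithin.mono hε)
  refine ⟨Z, hZ, fun ξ hξ => ?_⟩
  have h := hYZ _ _ (hYeq ⟨ξ, hξ⟩)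
  rw [hℓ] at h
  simpa [hξ] using h

lemma exists_algebra_of_gram_representation {n s : ℕ} {Q : Set (Fin n → ℝ)}
    (Y : (Fin n → ℝ) → Matrix (Fin s) (Fin s) ℝ) (hY : ∀ ξ ∈ Q, (Y ξ).PosSemidef) :
    ∃ (A : Type) (_ : CommRing A) (_ : Algebra ℝ A), Algebra.FiniteType ℝ A ∧ IsReduced A ∧
      ∃ (a : Fin n → A) (U : Submodule ℝ A), FiniteDimensional ℝ U ∧
        (∀ ξ ∈ Q, ∃ ρ : A →ₐ[ℝ] ℝ, ∀ i, ρ (a i) = ξ i) ∧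
        ∀ (c₀ : ℝ) (c : Fin n → ℝ) (Z : Matrix (Fin s) (Fin s) ℝ), Z.PosSemidef →
          (∀ ξ ∈ Q, c₀ + ∑ i, c i * ξ i = ∑ i, ∑ j, Y ξ i j * Z i j) →
          IsSumOfSquaresFrom U (algebraMap ℝ A c₀ + ∑ i, c i • a i) := by
  choose H hH using fun ξ : Q => (hY ξ ξ.2).exists_eq_gram
  let x : Fin n → Q → ℝ := fun i ξ => (ξ : Fin n → ℝ) i
  let y : Fin s × Fin s → Q → ℝ := fun k ξ => H ξ k.1 k.2
  let T : Set (Q → ℝ) := Set.range x ∪ Set.range y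
  let R : Subalgebra ℝ (Q → ℝ) := Algebra.adjoin ℝ T
  have hx : ∀ i, x i ∈ R := fun i => Algebra.subset_adjoin (Or.inl ⟨i, rfl⟩)
  have hy : ∀ k, y k ∈ R := fun k => Algebra.subset_adjoin (Or.inr ⟨k, rfl⟩)
  let v : Fin s × Fin s → R := fun k => ⟨y k, hy k⟩
  have hv : ∀ k, v k ∈ Submodule.span ℝ (Set.range v) := fun k => Submodule.subset_span ⟨k, rfl⟩
  refine ⟨R, inferInstance, inferInstance, ?_, ?_, fun i => ⟨x i, hx i⟩,
    Submodule.span ℝ (Set.range v), FiniteDimensional.span_of_finite ℝ (Set.finite_range v),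
    fun ξ hξ => ⟨(Pi.evalAlgHom ℝ (fun _ : Q => ℝ) ⟨ξ, hξ⟩).comp R.val, fun i => rfl⟩,
    fun c₀ c Z hZ h => ?_⟩
  · exact R.fg_iff_finiteType.mp
      (Subalgebra.fg_def.mpr ⟨T, (Set.finite_range x).union (Set.finite_range y), rfl⟩)
  · exact isReduced_of_injective R.val Subtype.val_injective
  · obtain ⟨G, hG⟩ := hZ.exists_eq_gram
    convert IsSumOfSquaresFrom.sum_sq (U := Submodule.span ℝ (Set.range v))
      (u := fun k : Fin s × Fin s => ∑ i, G k.2 i • v (k.1, i))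
      (fun k => Submodule.sum_mem _ fun i _ => Submodule.smul_mem _ _ (hv _)) using 1
    refine Subtype.ext (funext fun ξ => ?_)
    have key : ∑ i, ∑ j, Y ξ i j * Z i j = ∑ k, ∑ l, (∑ i, G l i * H ξ k i) ^ 2 := by
      simp only [hH]
      rw [gram_sum_mul_eq_sum]
      simp only [hG, gram_sum_mul]
    simpa [x, v, y, Fintype.sum_prod_type, Finset.sum_apply] using (h ξ ξ.2).trans key

theorem closure_convexHull_isSpectrahedralShadow_iff
    (n : ℕ) (S : Set (Fin n → ℝ)) (hS : IsSemialgebraic S)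
    (K : Set (Fin n → ℝ)) (hK : K = convexHull ℝ S) :
    IsSpectrahedralShadow (closure K) ↔
      ∃ (A : Type) (_ : CommRing A) (_ : Algebra ℝ A),
        Algebra.FiniteType ℝ A ∧ IsReduced A ∧
        ∃ (a : Fin n → A) (U : Submodule ℝ A), FiniteDimensional ℝ U ∧
          (∀ ξ ∈ S, ∃ ρ : A →ₐ[ℝ] ℝ, ∀ i, ρ (a i) = ξ i) ∧
          (∀ (c₀ : ℝ) (c : Fin n → ℝ), (∀ ξ ∈ S, 0 ≤ c₀ + ∑ i, c i * ξ i) →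
            IsSumOfSquaresFrom U (algebraMap ℝ A c₀ + ∑ i, c i • a i)) := by
  subst hK
  constructor
  · rintro ⟨d, m, -, M, B, C, hM, hB, hC, hQ⟩
    obtain ⟨s, Y, hY, hYZ⟩ := exists_gram_representation M B C hM hB hC hQ
    obtain ⟨A, hA, hAlg, hfin, hred, a, U, hU, hρ, hsos⟩ :=
      exists_algebra_of_gram_representation Y hY
    refine ⟨A, hA, hAlg, hfin, hred, a, U, hU,
      fun ξ hξ => hρ ξ (subset_closure (subset_convexHull ℝ S hξ)), fun c₀ c hc => ?_⟩
    obtain ⟨Z, hZ, h⟩ := hYZ c₀ c (affine_nonneg_of_mem_closure_convexHull hc)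
    exact hsos c₀ c Z hZ h
  · rintro ⟨A, _, _, -, -, a, U, hU, hρ, hsos⟩
    exact isSpectrahedralShadow_of_sumOfSquares a U hρ hsos
end

section
/- Let S ⊆ ℝ^n be a semialgebraic set and let C = cone(S) be the convex cone generated by S in ℝ^n (the set of all finite linear combinations of elements of S with nonnegative real coefficients). Then the closure of C is a spectrahedral shadow if and only if there exist a finitely generated reduced commutative ℝ-algebra A, elements a_1, …, a_n ∈ A, and a finite-dimensional ℝ-linear subspace U ⊆ A such that: (1) for every ξ ∈ S there exists an ℝ-algebra homomorphism ρ : A → ℝ with ρ(a_i) = ξ_i for i = 1, …, n; and (2) for every homogeneous linear polynomial f = c_1x_1 + … + c_nx_n with real coefficients satisfying f(ξ) ≥ 0 for all ξ ∈ S, the element c_1a_1 + … + c_na_n of A is a sum of squares of elements of U. -/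
/-- The convex cone generated by `M`: all finite nonnegative linear combinations. -/
def coneGen {k : ℕ} (M : Set (Fin k → ℝ)) : Set (Fin k → ℝ) :=
  {x | ∃ (s : ℕ) (c : Fin s → ℝ) (v : Fin s → (Fin k → ℝ)),
    (∀ i, 0 ≤ c i) ∧ (∀ i, v i ∈ M) ∧ x = ∑ i, c i • v i}

open Set Filter Topology
open scoped Matrix

/-- A point outside a closed convex cone is separated from it by a linear functional. -/
theorem exists_linearMap_nonneg_of_notMem_cone {E : Type*} [AddCommGroup E] [Module ℝ E]
    [TopologicalSpace E] [IsTopologicalAddGroup E] [ContinuousSMul ℝ E] [LocallyConvexSpace ℝ E]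
    {P : Set E} (hconv : Convex ℝ P) (hclosed : IsClosed P) (h0 : (0 : E) ∈ P)
    (hsmul : ∀ t : ℝ, 0 ≤ t → ∀ x ∈ P, t • x ∈ P) {x : E} (hx : x ∉ P) :
    ∃ φ : E →ₗ[ℝ] ℝ, (∀ y ∈ P, 0 ≤ φ y) ∧ φ x < 0 := by
  obtain ⟨φ, u, hxu, hu⟩ := geometric_hahn_banach_point_closed hconv hclosed hx
  have hu0 : u < 0 := by simpa using hu 0 h0
  refine ⟨φ.toLinearMap, fun y hy => ?_, hxu.trans hu0⟩
  change 0 ≤ φ y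
  by_contra! hneg
  have h := hu _ (hsmul (u / φ y) (div_nonneg_of_nonpos hu0.le hneg.le) y hy)
  rw [map_smul, smul_eq_mul, div_mul_cancel₀ _ hneg.ne] at h
  exact lt_irrefl _ h

/-- A positive semidefinite real matrix factors as `Hᵀ * H`. -/
theorem exists_eq_transpose_mul_self {ι : Type*} [Fintype ι] {M : Matrix ι ι ℝ}
    (hM : M.PosSemidef) : ∃ H : Matrix ι ι ℝ, M = Hᵀ * H := by
  classical
  open scoped MatrixOrder in
  obtain ⟨H, hH⟩ := CStarAlgebra.nonneg_iff_eq_star_mul_self.mp hM.nonneg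
  exact ⟨H, by rw [hH, Matrix.star_eq_conjTranspose, Matrix.conjTranspose_eq_transpose_of_trivial]⟩

section SumOfSquares

variable {A : Type*} [CommRing A] [Algebra ℝ A] {U : Submodule ℝ A}

theorem isSumOfSquaresFrom_sum {ι : Type*} (s : Finset ι) {u : ι → A} (hu : ∀ i ∈ s, u i ∈ U) :
    IsSumOfSquaresFrom U (∑ i ∈ s, u i ^ 2) := by
  refine ⟨s.card, fun k => u (s.equivFin.symm k), fun k => hu _ (s.equivFin.symm k).2, ?_⟩
  rw [← Finset.sum_coe_sort s, ← s.equivFin.symm.sum_comp]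

theorem isSumOfSquaresFrom_sq {u : A} (hu : u ∈ U) : IsSumOfSquaresFrom U (u ^ 2) :=
  ⟨1, fun _ => u, fun _ => hu, by simp⟩

theorem isSumOfSquaresFrom_zero : IsSumOfSquaresFrom U 0 :=
  ⟨0, Fin.elim0, fun i => i.elim0, by simp⟩

theorem IsSumOfSquaresFrom.add_s1 {x y : A} (hx : IsSumOfSquaresFrom U x)
    (hy : IsSumOfSquaresFrom U y) : IsSumOfSquaresFrom U (x + y) := by
  obtain ⟨s, u, hu, rfl⟩ := hx
  obtain ⟨t, v, hv, rfl⟩ := hy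
  have h := isSumOfSquaresFrom_sum (U := U) (u := Sum.elim u v) Finset.univ
    (by rintro (i | i) - <;> simp [hu, hv])
  simpa using h

theorem IsSumOfSquaresFrom.sum {ι : Type*} (s : Finset ι) {x : ι → A}
    (hx : ∀ i ∈ s, IsSumOfSquaresFrom U (x i)) : IsSumOfSquaresFrom U (∑ i ∈ s, x i) := by
  classical
  induction s using Finset.induction_on with
  | empty => simpa using isSumOfSquaresFrom_zero
  | insert i s hi ih =>
    rw [Finset.sum_insert hi]
    exact (hx i (by simp)).add_s1 (ih fun j hj => hx j (by simp [hj]))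

theorem IsSumOfSquaresFrom.smul {x : A} (hx : IsSumOfSquaresFrom U x) {t : ℝ} (ht : 0 ≤ t) :
    IsSumOfSquaresFrom U (t • x) := by
  obtain ⟨s, u, hu, rfl⟩ := hx
  refine ⟨s, fun i => √t • u i, fun i => U.smul_mem _ (hu i), ?_⟩
  simp [Finset.smul_sum, smul_pow, Real.sq_sqrt ht]

theorem IsSumOfSquaresFrom.map_nonneg_s1 {x : A} (hx : IsSumOfSquaresFrom U x) (φ : A →ₗ[ℝ] ℝ)
    (hφ : ∀ u ∈ U, 0 ≤ φ (u ^ 2)) : 0 ≤ φ x := by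
  obtain ⟨s, u, hu, rfl⟩ := hx
  rw [map_sum]
  exact Finset.sum_nonneg fun i _ => hφ _ (hu i)

/-- A sum of squares from a finite-dimensional space needs at most as many squares as the
dimension of the space. -/
theorem IsSumOfSquaresFrom.exists_finrank [FiniteDimensional ℝ U] {x : A}
    (hx : IsSumOfSquaresFrom U x) :
    ∃ w : Fin (Module.finrank ℝ U) → A, (∀ i, w i ∈ U) ∧ x = ∑ i, w i ^ 2 := by
  obtain ⟨s, u, hu, rfl⟩ := hx
  let b := Module.finBasis ℝ U
  have expand : ∀ {m : ℕ} (N : Matrix (Fin m) (Fin (Module.finrank ℝ U)) ℝ),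
      ∑ i, (∑ j, N i j • (b j : A)) ^ 2 = ∑ j, ∑ k, (Nᵀ * N) j k • ((b j : A) * b k) := by
    intro m N
    simp only [Matrix.mul_apply, Matrix.transpose_apply, Finset.sum_smul, sq,
      Finset.sum_mul_sum, smul_mul_smul_comm]
    rw [Finset.sum_comm]
    exact Finset.sum_congr rfl fun j _ => Finset.sum_comm
  let N : Matrix (Fin s) (Fin (Module.finrank ℝ U)) ℝ := fun i j => b.repr ⟨u i, hu i⟩ j
  have hN : ∀ i, u i = ∑ j, N i j • (b j : A) := fun i =>
    (congrArg (Subtype.val : U → A) (b.sum_repr ⟨u i, hu i⟩)).symm.trans (U.coe_sum _ _)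
  obtain ⟨H, hH⟩ := exists_eq_transpose_mul_self
    (by simpa using Matrix.posSemidef_conjTranspose_mul_self N : (Nᵀ * N).PosSemidef)
  refine ⟨fun i => ∑ j, H i j • (b j : A),
    fun i => U.sum_mem fun j _ => U.smul_mem _ (b j).2, ?_⟩
  simp only [hN, expand, hH]

/-- A space can be shrunk, without losing sums of squares representations of elements in the
range of `α`, to one in which every square is bounded above by some `α c`. -/
theorem exists_le_isSumOfSquaresFrom_sub_sq {V : Type*} [AddCommGroup V] [Module ℝ V]
    (U : Submodule ℝ A) (α : V →ₗ[ℝ] A) :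
    ∃ W ≤ U, (∀ c, IsSumOfSquaresFrom U (α c) → IsSumOfSquaresFrom W (α c)) ∧
      ∀ w ∈ W, ∃ c, IsSumOfSquaresFrom W (α c - w ^ 2) := by
  let W : Submodule ℝ A :=
    { carrier := {u | u ∈ U ∧ ∃ c, IsSumOfSquaresFrom U (α c - u ^ 2)}
      zero_mem' := ⟨U.zero_mem, 0, by simpa using isSumOfSquaresFrom_zero⟩
      add_mem' := by
        rintro u v ⟨hu, c, hc⟩ ⟨hv, d, hd⟩
        refine ⟨U.add_mem hu hv, c + d + (c + d), ?_⟩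
        have h := (((hc.add_s1 hd).add_s1 (hc.add_s1 hd))).add_s1 (isSumOfSquaresFrom_sq (U.sub_mem hu hv))
        convert h using 1
        simp only [map_add]
        ring
      smul_mem' := by
        rintro t u ⟨hu, c, hc⟩
        refine ⟨U.smul_mem t hu, t ^ 2 • c, ?_⟩
        have h := hc.smul (sq_nonneg t)
        rwa [smul_sub, ← smul_pow, ← map_smul] at h }
  have key : ∀ c (s : ℕ) (u : Fin s → A), (∀ i, u i ∈ U) → α c = ∑ i, u i ^ 2 →
      ∀ i, u i ∈ W := by
    intro c s u hu hc i
    refine ⟨hu i, c, ?_⟩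
    rw [hc, ← Finset.add_sum_erase _ _ (Finset.mem_univ i), add_sub_cancel_left]
    exact isSumOfSquaresFrom_sum _ fun j _ => hu j
  refine ⟨W, fun u hu => hu.1, ?_, ?_⟩
  · rintro c ⟨s, u, hu, hc⟩
    exact ⟨s, u, key c s u hu hc, hc⟩
  · rintro w ⟨hw, c, s, u, hu, hc⟩
    have hc' : α c = ∑ i, (Fin.cons w u : Fin (s + 1) → A) i ^ 2 := by
      rw [Fin.sum_univ_succ]
      simp [← hc]
    have h := key c (s + 1) (Fin.cons w u) (Fin.cases hw hu) hc'
    exact ⟨c, s, u, fun i => by simpa using h i.succ, hc⟩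

end SumOfSquares

/-- Sums of squares from a finite-dimensional space of functions form a closed set in the topology
of pointwise convergence. -/
theorem isClosed_setOf_isSumOfSquaresFrom {X : Type*} (U : Submodule ℝ (X → ℝ))
    [FiniteDimensional ℝ U] : IsClosed {f | IsSumOfSquaresFrom U f} := by
  have hproper : IsProperMap (fun v : Fin (Module.finrank ℝ U) → ℝ => ∑ i, v i ^ 2) := by
    have hcont : Continuous (fun v : Fin (Module.finrank ℝ U) → ℝ => ∑ i, v i ^ 2) := by fun_prop
    refine isProperMap_iff_tendsto_cocompact.2 ⟨hcont, ?_⟩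
    refine Tendsto.mono_right (tendsto_atTop_mono ?_
      ((tendsto_pow_atTop two_ne_zero).comp (tendsto_norm_cocompact_atTop (E := Fin (Module.finrank ℝ U) → ℝ))))
      atTop_le_cocompact
    intro v
    have h : ‖v‖ ≤ √(∑ i, v i ^ 2) := by
      refine (pi_norm_le_iff_of_nonneg (Real.sqrt_nonneg _)).2 fun i => Real.abs_le_sqrt ?_
      exact Finset.single_le_sum (f := fun i => v i ^ 2) (fun i _ => sq_nonneg _)
        (Finset.mem_univ i)
    simpa using (Real.le_sqrt (norm_nonneg _) (Finset.sum_nonneg fun i _ => sq_nonneg _)).1 h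
  have hclosed : IsClosed {g : X → Fin (Module.finrank ℝ U) → ℝ | ∀ i, (fun x => g x i) ∈ U} := by
    simp only [ofPred_forall]
    refine isClosed_iInter fun i => U.closed_of_finiteDimensional.preimage ?_
    fun_prop
  convert (IsProperMap.pi_map fun _ : X => hproper).isClosedMap _ hclosed using 1
  ext f
  constructor
  · intro hf
    obtain ⟨w, hw, rfl⟩ := hf.exists_finrank
    exact ⟨fun x i => w i x, hw, by ext x; simp⟩
  · rintro ⟨g, hg, rfl⟩
    exact ⟨_, fun i x => g x i, hg, by ext x; simp⟩

section Shadow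

variable {n : ℕ}

theorem isSpectrahedralShadow_setOf_linearMap {ι κ : Type*} [Fintype ι] [Nonempty ι] [Finite κ]
    (F : (Fin n → ℝ) × (κ → ℝ) →ₗ[ℝ] Matrix ι ι ℝ) (hF : ∀ p, (F p).IsSymm) :
    IsSpectrahedralShadow {ξ | ∃ η, (F (ξ, η)).PosSemidef} := by
  classical
  have := Fintype.ofFinite κ
  let e := Fintype.equivFin ι
  let f := Fintype.equivFin κ
  refine ⟨Fintype.card ι, Fintype.card κ, Fintype.card_pos, 0,
    fun i => (F (Pi.single i 1, 0)).submatrix e.symm e.symm,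
    fun j => (F (0, Pi.single (f.symm j) 1)).submatrix e.symm e.symm,
    Matrix.isSymm_zero, fun i => (hF _).submatrix _, fun j => (hF _).submatrix _, ?_⟩
  have key : ∀ ξ (η : κ → ℝ), (0 : Matrix (Fin (Fintype.card ι)) (Fin (Fintype.card ι)) ℝ) +
      ∑ i, ξ i • (F (Pi.single i 1, 0)).submatrix e.symm e.symm +
      ∑ j, η (f.symm j) • (F (0, Pi.single (f.symm j) 1)).submatrix e.symm e.symm =
      (F (ξ, η)).submatrix e.symm e.symm := by
    intro ξ η
    have h1 : (ξ, η) = ∑ i, ξ i • ((Pi.single i 1, 0) : (Fin n → ℝ) × (κ → ℝ)) +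
        ∑ k, η k • ((0, Pi.single k 1) : (Fin n → ℝ) × (κ → ℝ)) := by
      ext k <;> simp [Prod.fst_sum, Prod.snd_sum, Finset.sum_apply, Pi.single_apply]
    rw [h1, f.symm.sum_comp fun k => η k • (F (0, Pi.single k 1)).submatrix e.symm e.symm]
    ext a b
    simp [Matrix.sum_apply, -Prod.smul_mk]
  ext ξ
  constructor
  · rintro ⟨η, h⟩
    refine ⟨fun j => η (f.symm j), ?_⟩
    rw [key]
    exact h.submatrix _
  · rintro ⟨η, h⟩
    refine ⟨fun k => η (f k), ?_⟩
    have h2 := key ξ fun k => η (f k)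
    simp only [Equiv.apply_symm_apply] at h2
    rw [h2] at h
    exact (Matrix.posSemidef_submatrix_equiv e.symm).1 h

theorem posSemidef_fromBlocks_diagonal_iff {ι κ : Type*} [Fintype ι] [Fintype κ]
    {M : Matrix ι ι ℝ} {N : Matrix κ κ ℝ} :
    (Matrix.fromBlocks M 0 0 N).PosSemidef ↔ M.PosSemidef ∧ N.PosSemidef := by
  constructor
  · exact fun h => ⟨h.submatrix Sum.inl, h.submatrix Sum.inr⟩
  · rintro ⟨hM, hN⟩
    refine .of_dotProduct_mulVec_nonneg (.fromBlocks hM.1 Matrix.conjTranspose_zero hN.1) fun v => ?_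
    have h := add_nonneg (hM.dotProduct_mulVec_nonneg (v ∘ Sum.inl))
      (hN.dotProduct_mulVec_nonneg (v ∘ Sum.inr))
    simpa [dotProduct, Matrix.mulVec, Fintype.sum_sum_type] using h

/-- The linear image of a cone cut out by a linear matrix inequality is a spectrahedral shadow. -/
theorem isSpectrahedralShadow_image {V ι : Type*} [AddCommGroup V] [Module ℝ V]
    [FiniteDimensional ℝ V] [Fintype ι] (T : V →ₗ[ℝ] Fin n → ℝ) (N : V →ₗ[ℝ] Matrix ι ι ℝ)
    (hN : ∀ p, (N p).IsSymm) :
    IsSpectrahedralShadow (image T {p | (N p).PosSemidef}) := by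
  classical
  let e := (Module.finBasis ℝ V).equivFun.symm
  let d : (Fin n → ℝ) × (Fin (Module.finrank ℝ V) → ℝ) →ₗ[ℝ] Fin n → ℝ :=
    LinearMap.fst ℝ _ _ - T ∘ₗ e.toLinearMap ∘ₗ LinearMap.snd ℝ _ _
  let G : (Fin n → ℝ) × (Fin (Module.finrank ℝ V) → ℝ) →ₗ[ℝ]
      Matrix (ι ⊕ Fin n ⊕ Fin n ⊕ Unit) (ι ⊕ Fin n ⊕ Fin n ⊕ Unit) ℝ :=
    { toFun := fun p => Matrix.fromBlocks (N (e p.2)) 0 0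
        (Matrix.diagonal (Sum.elim (d p) (Sum.elim (-d p) 0)))
      map_add' := fun p q => by
        ext (i | i | i | i) (j | j | j | j) <;>
          simp [Matrix.diagonal_apply] <;> split_ifs <;> ring
      map_smul' := fun t p => by
        ext (i | i | i | i) (j | j | j | j) <;>
          simp [Matrix.diagonal_apply] }
  convert isSpectrahedralShadow_setOf_linearMap G fun p =>
    Matrix.IsSymm.fromBlocks (hN _) Matrix.transpose_zero (Matrix.isSymm_diagonal _) using 1
  ext ξ
  have hG : ∀ η, (G (ξ, η)).PosSemidef ↔ (N (e η)).PosSemidef ∧ T (e η) = ξ := by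
    intro η
    change (Matrix.fromBlocks _ _ _ _).PosSemidef ↔ _
    rw [posSemidef_fromBlocks_diagonal_iff, Matrix.posSemidef_diagonal_iff]
    refine and_congr_right fun _ => ⟨fun h => ?_, ?_⟩
    · ext i
      have h1 := h (.inl i)
      have h2 := h (.inr (.inl i))
      simp only [Sum.elim_inl, Sum.elim_inr, Pi.neg_apply] at h1 h2
      have h3 : d (ξ, η) i = ξ i - T (e η) i := rfl
      linarith
    · rintro rfl (i | i | i) <;> simp [d]
  simp only [mem_image, mem_ofPred_eq, hG]
  exact e.symm.toEquiv.exists_congr fun p => by simp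

end Shadow

section Cone

variable {n : ℕ} {S : Set (Fin n → ℝ)}

theorem zero_mem_coneGen : (0 : Fin n → ℝ) ∈ coneGen S :=
  ⟨0, Fin.elim0, Fin.elim0, fun i => i.elim0, fun i => i.elim0, by simp⟩

theorem smul_mem_coneGen {x : Fin n → ℝ} (hx : x ∈ coneGen S) {t : ℝ} (ht : 0 ≤ t) :
    t • x ∈ coneGen S := by
  obtain ⟨s, c, v, hc, hv, rfl⟩ := hx
  exact ⟨s, fun i => t * c i, v, fun i => mul_nonneg ht (hc i), hv,
    by simp [Finset.smul_sum, mul_smul]⟩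

theorem add_mem_coneGen {x y : Fin n → ℝ} (hx : x ∈ coneGen S) (hy : y ∈ coneGen S) :
    x + y ∈ coneGen S := by
  obtain ⟨s, c, v, hc, hv, rfl⟩ := hx
  obtain ⟨t, d, w, hd, hw, rfl⟩ := hy
  refine ⟨s + t, Fin.append c d, Fin.append v w, ?_, ?_, by simp [Fin.sum_univ_add]⟩
  · exact Fin.addCases (by simpa using hc) (by simpa using hd)
  · exact Fin.addCases (by simpa using hv) (by simpa using hw)

theorem subset_coneGen : S ⊆ coneGen S := fun x hx =>
  ⟨1, fun _ => 1, fun _ => x, by simp, by simpa using hx, by simp⟩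

theorem convex_coneGen : Convex ℝ (coneGen S) := fun _ hx _ hy _ _ ha hb _ =>
  add_mem_coneGen (smul_mem_coneGen hx ha) (smul_mem_coneGen hy hb)

/-- A linear form that is nonnegative on `S` is nonnegative on the closed cone generated by `S`. -/
theorem sum_mul_nonneg_of_mem_closure_coneGen {c : Fin n → ℝ}
    (hc : ∀ ξ ∈ S, 0 ≤ ∑ i, c i * ξ i) {x : Fin n → ℝ} (hx : x ∈ closure (coneGen S)) :
    0 ≤ ∑ i, c i * x i := by
  have hclosed : IsClosed {x : Fin n → ℝ | 0 ≤ ∑ i, c i * x i} :=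
    isClosed_le continuous_const (by fun_prop)
  refine closure_minimal ?_ hclosed hx
  rintro _ ⟨s, t, v, ht, hv, rfl⟩
  change 0 ≤ c ⬝ᵥ ∑ j, t j • v j
  rw [dotProduct_sum]
  refine Finset.sum_nonneg fun j _ => ?_
  rw [dotProduct_smul]
  exact mul_nonneg (ht j) (hc _ (hv j))

/-- The bipolar theorem for the cone generated by `S`. -/
theorem mem_closure_coneGen {x : Fin n → ℝ}
    (hx : ∀ c : Fin n → ℝ, (∀ ξ ∈ S, 0 ≤ ∑ i, c i * ξ i) → 0 ≤ ∑ i, c i * x i) :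
    x ∈ closure (coneGen S) := by
  by_contra hmem
  obtain ⟨φ, hφ, hφx⟩ := exists_linearMap_nonneg_of_notMem_cone convex_coneGen.closure
    isClosed_closure (subset_closure zero_mem_coneGen)
    (fun t ht y hy => map_mem_closure (continuous_const_smul t) hy
      fun z hz => smul_mem_coneGen hz ht) hmem
  have hrep : ∀ y, φ y = ∑ i, φ (Pi.single i 1) * y i := fun y => by
    rw [LinearMap.pi_apply_eq_sum_univ φ y]
    refine Finset.sum_congr rfl fun i _ => ?_
    rw [smul_eq_mul, mul_comm]
    congr 2
    ext j
    simp [Pi.single_apply, eq_comm]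
  rw [hrep] at hφx
  refine hφx.not_ge (hx _ fun ξ hξ => ?_)
  rw [← hrep]
  exact hφ _ (subset_closure (subset_coneGen hξ))

end Cone

section SumOfSquaresRepresentation

variable {n : ℕ} {A : Type*} [CommRing A] [Algebra ℝ A]

/-- The moment vectors of linear functionals that are nonnegative on squares from a
finite-dimensional space form a spectrahedral shadow. -/
theorem isSpectrahedralShadow_moments (a : Fin n → A) (W : Submodule ℝ A)
    [FiniteDimensional ℝ W] :
    IsSpectrahedralShadow
      {ξ | ∃ φ : A →ₗ[ℝ] ℝ, (∀ i, φ (a i) = ξ i) ∧ ∀ w ∈ W, 0 ≤ φ (w ^ 2)} := by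
  let b := Module.finBasis ℝ W
  let Λ : (A →ₗ[ℝ] ℝ) →ₗ[ℝ] (Fin n → ℝ) ×
      Matrix (Fin (Module.finrank ℝ W)) (Fin (Module.finrank ℝ W)) ℝ :=
    { toFun := fun φ => (fun i => φ (a i), fun j k => φ ((b j : A) * b k))
      map_add' := fun _ _ => rfl
      map_smul' := fun _ _ => rfl }
  have hsymm : ∀ φ, (Λ φ).2.IsSymm := fun φ => by
    ext j k
    exact congrArg φ (mul_comm _ _)
  have hpsd : ∀ φ, (Λ φ).2.PosSemidef ↔ ∀ w ∈ W, 0 ≤ φ (w ^ 2) := by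
    intro φ
    have hquad : ∀ v : Fin (Module.finrank ℝ W) → ℝ,
        star v ⬝ᵥ ((Λ φ).2 *ᵥ v) = φ ((∑ j, v j • (b j : A)) ^ 2) := by
      intro v
      rw [sq, Finset.sum_mul_sum]
      simp only [dotProduct, Matrix.mulVec, Finset.mul_sum, map_sum, smul_mul_smul_comm, map_smul,
        smul_eq_mul]
      refine Finset.sum_congr rfl fun j _ => Finset.sum_congr rfl fun k _ => ?_
      change v j * (φ ((b j : A) * b k) * v k) = _
      ring
    rw [Matrix.posSemidef_iff_dotProduct_mulVec]
    constructor
    · rintro ⟨-, h⟩ w hw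
      have hw' : w = ∑ j, b.repr ⟨w, hw⟩ j • (b j : A) :=
        (congrArg (Subtype.val : W → A) (b.sum_repr ⟨w, hw⟩)).symm.trans (W.coe_sum _ _)
      rw [hw', ← hquad]
      exact h _
    · intro h
      refine ⟨(Matrix.conjTranspose_eq_transpose_of_trivial _).trans (hsymm φ), fun v => ?_⟩
      rw [hquad]
      exact h _ (W.sum_mem fun j _ => W.smul_mem _ (b j).2)
  convert isSpectrahedralShadow_image (V := LinearMap.range Λ)
    (LinearMap.fst ℝ _ _ ∘ₗ (LinearMap.range Λ).subtype)
    (LinearMap.snd ℝ _ _ ∘ₗ (LinearMap.range Λ).subtype)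
    (by rintro ⟨_, φ, rfl⟩; exact hsymm φ) using 1
  ext ξ
  constructor
  · rintro ⟨φ, h1, h2⟩
    exact ⟨⟨Λ φ, φ, rfl⟩, (hpsd φ).2 h2, funext h1⟩
  · rintro ⟨⟨_, φ, rfl⟩, h1, h2⟩
    exact ⟨φ, fun i => congrFun h2 i, (hpsd φ).1 h1⟩

/-- If every square from `W` is bounded above by an element of the span of `a`, then the moment
vectors of linear functionals nonnegative on squares from `W` form a closed set. -/
theorem isClosed_moments (a : Fin n → A) (W : Submodule ℝ A) [FiniteDimensional ℝ W]
    (hW : ∀ w ∈ W, ∃ c : Fin n → ℝ,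
      IsSumOfSquaresFrom W (Fintype.linearCombination ℝ a c - w ^ 2)) :
    IsClosed {ξ : Fin n → ℝ |
      ∃ φ : A →ₗ[ℝ] ℝ, (∀ i, φ (a i) = ξ i) ∧ ∀ w ∈ W, 0 ≤ φ (w ^ 2)} := by
  let b := Module.finBasis ℝ W
  let Λ : (A →ₗ[ℝ] ℝ) →ₗ[ℝ] (Fin n → ℝ) ×
      (Fin (Module.finrank ℝ W) → Fin (Module.finrank ℝ W) → ℝ) :=
    { toFun := fun φ => (fun i => φ (a i), fun j k => φ ((b j : A) * b k))
      map_add' := fun _ _ => rfl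
      map_smul' := fun _ _ => rfl }
  have hexpand : ∀ w (hw : w ∈ W) (φ : A →ₗ[ℝ] ℝ), φ (w ^ 2) =
      ∑ j, ∑ k, (b.repr ⟨w, hw⟩ j * b.repr ⟨w, hw⟩ k) * (Λ φ).2 j k := by
    intro w hw φ
    have hw' : w = ∑ j, b.repr ⟨w, hw⟩ j • (b j : A) :=
      (congrArg (Subtype.val : W → A) (b.sum_repr ⟨w, hw⟩)).symm.trans (W.coe_sum _ _)
    conv_lhs => rw [hw']
    simp only [sq, Finset.sum_mul_sum, map_sum, smul_mul_smul_comm, map_smul, smul_eq_mul]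
    rfl
  choose c hc using fun j => hW (b j) (b j).2
  have hdiag : ∀ φ : A →ₗ[ℝ] ℝ, (∀ w ∈ W, 0 ≤ φ (w ^ 2)) → ∀ j,
      φ ((b j : A) ^ 2) ≤ ∑ i, c j i * φ (a i) := by
    intro φ hφ j
    have h := (hc j).map_nonneg_s1 φ hφ
    simp only [Fintype.linearCombination_apply, map_sub, map_sum, map_smul, smul_eq_mul] at h
    linarith
  have hoff : ∀ φ : A →ₗ[ℝ] ℝ, (∀ w ∈ W, 0 ≤ φ (w ^ 2)) → ∀ j k,
      |φ ((b j : A) * b k)| ≤ φ ((b j : A) ^ 2) + φ ((b k : A) ^ 2) := by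
    intro φ hφ j k
    have hj := hφ _ (b j).2
    have hk := hφ _ (b k).2
    have h1 := hφ _ (W.add_mem (b j).2 (b k).2)
    have h2 := hφ _ (W.sub_mem (b j).2 (b k).2)
    rw [show ((b j : A) + b k) ^ 2 = (b j : A) ^ 2 + ((b j : A) * b k + (b j : A) * b k) +
      (b k : A) ^ 2 by ring] at h1
    rw [show ((b j : A) - b k) ^ 2 = (b j : A) ^ 2 - ((b j : A) * b k + (b j : A) * b k) +
      (b k : A) ^ 2 by ring] at h2
    simp only [map_add, map_sub] at h1 h2
    rw [abs_le]
    constructor <;> linarith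
  refine isClosed_of_closure_subset fun ξ hξ => ?_
  obtain ⟨x, hx, hlim⟩ := mem_closure_iff_seq_limit.1 hξ
  choose φ hφa hφW using hx
  have hfst : ∀ m, (Λ (φ m)).1 = x m := fun m => funext (hφa m)
  have hbound : ∀ j, ∃ B, ∀ m, ∑ i, c j i * x m i ≤ B := by
    intro j
    have hcont : Continuous fun y : Fin n → ℝ => ∑ i, c j i * y i := by fun_prop
    obtain ⟨B, hB⟩ := ((hcont.tendsto ξ).comp hlim).bddAbove_range
    exact ⟨B, fun m => hB ⟨m, rfl⟩⟩
  choose B hB using hbound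
  have hmem : ∀ m, (Λ (φ m)).2 ∈
      Set.Icc (fun j k => -(B j + B k)) (fun j k => B j + B k) := by
    intro m
    have h : ∀ j k, |(Λ (φ m)).2 j k| ≤ B j + B k := fun j k => by
      refine (hoff _ (hφW m) j k).trans (add_le_add ?_ ?_)
      · exact (hdiag _ (hφW m) j).trans (by simpa only [hφa] using hB j m)
      · exact (hdiag _ (hφW m) k).trans (by simpa only [hφa] using hB k m)
    exact ⟨fun j k => (abs_le.1 (h j k)).1, fun j k => (abs_le.1 (h j k)).2⟩
  obtain ⟨M, -, ψ, hψ, hM⟩ := isCompact_Icc.tendsto_subseq hmem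
  have hpair : Tendsto (fun m => Λ (φ (ψ m))) atTop (𝓝 (ξ, M)) := by
    rw [Prod.tendsto_iff]
    exact ⟨(hlim.comp hψ.tendsto_atTop).congr fun m => (hfst _).symm, hM⟩
  obtain ⟨φ', hφ'⟩ := (LinearMap.range Λ).closed_of_finiteDimensional.mem_of_tendsto hpair
    (Eventually.of_forall fun m => ⟨_, rfl⟩)
  refine ⟨φ', fun i => congrFun (congrArg Prod.fst hφ') i, fun w hw => ?_⟩
  rw [hexpand w hw, hφ']
  have hcont : Continuous fun N : Fin (Module.finrank ℝ W) → Fin (Module.finrank ℝ W) → ℝ =>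
      ∑ j, ∑ k, (b.repr ⟨w, hw⟩ j * b.repr ⟨w, hw⟩ k) * N j k := by fun_prop
  refine ge_of_tendsto ((hcont.tendsto M).comp hM) (Eventually.of_forall fun m => ?_)
  have h := hφW (ψ m) w hw
  rwa [hexpand w hw] at h

theorem isSpectrahedralShadow_closure_coneGen_of_isSumOfSquaresFrom {S : Set (Fin n → ℝ)}
    (a : Fin n → A) (U : Submodule ℝ A) [FiniteDimensional ℝ U]
    (hρ : ∀ ξ ∈ S, ∃ ρ : A →ₐ[ℝ] ℝ, ∀ i, ρ (a i) = ξ i)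
    (hU : ∀ c : Fin n → ℝ, (∀ ξ ∈ S, 0 ≤ ∑ i, c i * ξ i) →
      IsSumOfSquaresFrom U (∑ i, c i • a i)) :
    IsSpectrahedralShadow (closure (coneGen S)) := by
  obtain ⟨W, hWU, hW, hbdd⟩ :=
    exists_le_isSumOfSquaresFrom_sub_sq U (Fintype.linearCombination ℝ a)
  have := Submodule.finiteDimensional_of_le hWU
  convert isSpectrahedralShadow_moments a W using 1
  refine (closure_minimal ?_ (isClosed_moments a W hbdd)).antisymm ?_
  · rintro _ ⟨s, t, v, ht, hv, rfl⟩
    choose ρ hρ using fun j => hρ (v j) (hv j)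
    refine ⟨∑ j, t j • (ρ j).toLinearMap, fun i => by simp [hρ], fun w _ => ?_⟩
    simp only [LinearMap.coe_sum, Finset.sum_apply, LinearMap.smul_apply, AlgHom.toLinearMap_apply,
      map_pow, smul_eq_mul]
    exact Finset.sum_nonneg fun j _ => mul_nonneg (ht j) (sq_nonneg _)
  · rintro ξ ⟨φ, hφa, hφW⟩
    refine mem_closure_coneGen fun c hc => ?_
    have h := (hW c (hU c hc)).map_nonneg_s1 φ hφW
    simpa [Fintype.linearCombination_apply, hφa] using h

end SumOfSquaresRepresentation

/-- A linear form that is nonnegative on a spectrahedral shadow containing the origin becomes a sum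
of squares of functions from a fixed finite-dimensional space on the spectrahedron. -/
theorem isSumOfSquaresFrom_of_nonneg {n d m : ℕ} {M₀ : Matrix (Fin d) (Fin d) ℝ}
    {B : Fin n → Matrix (Fin d) (Fin d) ℝ} {C : Fin m → Matrix (Fin d) (Fin d) ℝ}
    (hM₀ : M₀.IsSymm) (hB : ∀ i, (B i).IsSymm) (hC : ∀ j, (C j).IsSymm)
    {X : Type*} {x : X → Fin n → ℝ} {y : X → Fin m → ℝ} {Z : X → Matrix (Fin d) (Fin d) ℝ}
    (hZ : ∀ p, M₀ + ∑ i, x p i • B i + ∑ j, y p j • C j = (Z p)ᵀ * Z p)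
    {p₀ : X} (hp₀ : x p₀ = 0) {U : Submodule ℝ (X → ℝ)} [FiniteDimensional ℝ U]
    (hU1 : 1 ∈ U) (hUZ : ∀ j k, (fun p => Z p j k) ∈ U) {c : Fin n → ℝ}
    (hc : ∀ ξ : Fin n → ℝ, (∃ η : Fin m → ℝ,
      (M₀ + ∑ i, ξ i • B i + ∑ j, η j • C j).PosSemidef) → 0 ≤ ∑ i, c i * ξ i) :
    IsSumOfSquaresFrom U (fun p => ∑ i, c i * x p i) := by
  by_contra hf
  obtain ⟨φ₀, hφ₀, hφ₀f⟩ := exists_linearMap_nonneg_of_notMem_cone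
    (P := {f | IsSumOfSquaresFrom U f})
    (fun _ hg _ hh _ _ hs ht _ => (hg.smul hs).add_s1 (hh.smul ht))
    (isClosed_setOf_isSumOfSquaresFrom U) isSumOfSquaresFrom_zero (fun _ ht _ hg => hg.smul ht) hf
  -- Adding the evaluation at `p₀` makes the functional strictly positive at `1`.
  let φ : (X → ℝ) →ₗ[ℝ] ℝ := φ₀ + LinearMap.proj p₀
  have hφ : ∀ g ∈ U, 0 ≤ φ (g ^ 2) := fun g hg =>
    add_nonneg (hφ₀ _ (isSumOfSquaresFrom_sq hg)) (sq_nonneg (g p₀))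
  have hτ : 0 < φ 1 := by
    have h := hφ₀ _ (isSumOfSquaresFrom_sq hU1)
    rw [one_pow] at h
    exact add_pos_of_nonneg_of_pos h one_pos
  have hφf : φ (fun p => ∑ i, c i * x p i) < 0 := by simpa [φ, hp₀] using hφ₀f
  set τ := φ 1
  have hpsd : (M₀ + ∑ i, (τ⁻¹ * φ (fun p => x p i)) • B i +
      ∑ j, (τ⁻¹ * φ (fun p => y p j)) • C j).PosSemidef := by
    refine .of_dotProduct_mulVec_nonneg ?_ fun v => ?_
    · rw [Matrix.IsHermitian, Matrix.conjTranspose_eq_transpose_of_trivial]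
      simp only [Matrix.transpose_add, Matrix.transpose_sum, Matrix.transpose_smul, hM₀.eq,
        (hB _).eq, (hC _).eq]
    · let q : Matrix (Fin d) (Fin d) ℝ →ₗ[ℝ] ℝ :=
        { toFun := fun M => v ⬝ᵥ (M *ᵥ v)
          map_add' := fun M N => by simp [Matrix.add_mulVec]
          map_smul' := fun t M => by simp [Matrix.smul_mulVec] }
      have hfun : (∑ k, (∑ j, v j • (fun p => Z p k j)) ^ 2 : X → ℝ) =
          q M₀ • 1 + ∑ i, q (B i) • (fun p => x p i) + ∑ j, q (C j) • (fun p => y p j) := by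
        ext p
        have h1 := congrArg q (hZ p)
        have h2 : q ((Z p)ᵀ * Z p) = ∑ k, (∑ j, v j * Z p k j) ^ 2 := by
          change v ⬝ᵥ (((Z p)ᵀ * Z p) *ᵥ v) = _
          rw [← Matrix.mulVec_mulVec, Matrix.dotProduct_mulVec, Matrix.vecMul_transpose]
          simp [dotProduct, Matrix.mulVec, sq, mul_comm]
        rw [h2] at h1
        simp only [map_add, map_sum, map_smul, smul_eq_mul] at h1
        have h3 : (∑ k, (∑ j, v j • (fun p => Z p k j)) ^ 2 : X → ℝ) p =
            ∑ k, (∑ j, v j * Z p k j) ^ 2 := by simp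
        rw [h3, ← h1]
        simp [mul_comm]
      have hpos : 0 ≤ φ (∑ k, (∑ j, v j • (fun p => Z p k j)) ^ 2) := by
        rw [map_sum]
        exact Finset.sum_nonneg fun k _ =>
          hφ _ (U.sum_mem fun j _ => U.smul_mem _ (hUZ k j))
      rw [hfun] at hpos
      simp only [map_add, map_sum, map_smul, smul_eq_mul] at hpos
      change 0 ≤ q _
      have heq : q (M₀ + ∑ i, (τ⁻¹ * φ (fun p => x p i)) • B i +
          ∑ j, (τ⁻¹ * φ (fun p => y p j)) • C j) = τ⁻¹ * (q M₀ * τ +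
          ∑ i, q (B i) * φ (fun p => x p i) + ∑ j, q (C j) * φ (fun p => y p j)) := by
        simp only [map_add, map_sum, map_smul, smul_eq_mul, mul_add, Finset.mul_sum]
        congr 1
        · congr 1
          · field_simp
          · exact Finset.sum_congr rfl fun i _ => by ring
        · exact Finset.sum_congr rfl fun i _ => by ring
      rw [heq]
      exact mul_nonneg (inv_nonneg.2 hτ.le) hpos
  have hnonneg := hc _ ⟨_, hpsd⟩
  have heq : ∑ i, c i * (τ⁻¹ * φ (fun p => x p i)) =
      τ⁻¹ * φ (fun p => ∑ i, c i * x p i) := by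
    have hfun : (fun p => ∑ i, c i * x p i) = ∑ i, c i • (fun p => x p i) := by
      ext p
      simp
    rw [hfun]
    simp only [map_sum, map_smul, smul_eq_mul, Finset.mul_sum]
    exact Finset.sum_congr rfl fun i _ => by ring
  rw [heq] at hnonneg
  exact hnonneg.not_gt (mul_neg_of_pos_of_neg (inv_pos.2 hτ) hφf)

theorem exists_isSumOfSquaresFrom_of_isSpectrahedralShadow {n : ℕ} {S : Set (Fin n → ℝ)}
    (h : IsSpectrahedralShadow (closure (coneGen S))) :
    ∃ (A : Type) (_ : CommRing A) (_ : Algebra ℝ A),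
      Algebra.FiniteType ℝ A ∧ IsReduced A ∧
      ∃ (a : Fin n → A) (U : Submodule ℝ A), FiniteDimensional ℝ U ∧
        (∀ ξ ∈ S, ∃ ρ : A →ₐ[ℝ] ℝ, ∀ i, ρ (a i) = ξ i) ∧
        (∀ c : Fin n → ℝ, (∀ ξ ∈ S, 0 ≤ ∑ i, c i * ξ i) →
          IsSumOfSquaresFrom U (∑ i, c i • a i)) := by
  obtain ⟨d, m, -, M₀, B, C, hM₀, hB, hC, hK⟩ := h
  let X : Type := {p : (Fin n → ℝ) × (Fin m → ℝ) //
    (M₀ + ∑ i, p.1 i • B i + ∑ j, p.2 j • C j).PosSemidef}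
  have hX : ∀ ξ ∈ closure (coneGen S), ∃ p : X, p.1.1 = ξ := by
    intro ξ hξ
    rw [hK] at hξ
    obtain ⟨η, hη⟩ := hξ
    exact ⟨⟨(ξ, η), hη⟩, rfl⟩
  obtain ⟨p₀, hp₀⟩ := hX 0 (subset_closure zero_mem_coneGen)
  choose Z hZ using fun p : X => exists_eq_transpose_mul_self p.2
  let coord : Fin n → X → ℝ := fun i p => p.1.1 i
  let sqrtEntry : Fin d × Fin d → X → ℝ := fun jk p => Z p jk.1 jk.2
  let A : Subalgebra ℝ (X → ℝ) := Algebra.adjoin ℝ (range coord ∪ range sqrtEntry)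
  let U : Submodule ℝ (X → ℝ) := Submodule.span ℝ (insert 1 (range sqrtEntry))
  have hUfin : FiniteDimensional ℝ U :=
    FiniteDimensional.span_of_finite ℝ ((finite_range _).insert _)
  have hcoord : ∀ i, coord i ∈ A := fun i => Algebra.subset_adjoin (.inl ⟨i, rfl⟩)
  have hUA : U ≤ A.toSubmodule := by
    refine Submodule.span_le.2 (insert_subset A.one_mem ?_)
    exact fun g hg => Algebra.subset_adjoin (.inr hg)
  have hinj : Function.Injective A.val := Subtype.val_injective
  refine ⟨A, inferInstance, inferInstance, ?_, isReduced_of_injective A.val hinj,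
    fun i => ⟨coord i, hcoord i⟩, U.comap A.val.toLinearMap, ?_, ?_, ?_⟩
  · exact (Subalgebra.fg_iff_finiteType A).1
      (Subalgebra.fg_def.2 ⟨_, (finite_range _).union (finite_range _), rfl⟩)
  · exact Module.Finite.of_injective (A.val.toLinearMap.restrict fun g hg => hg :
      U.comap A.val.toLinearMap →ₗ[ℝ] U) fun g h hgh =>
        Subtype.ext (hinj (congrArg (fun z : U => z.1) hgh))
  · intro ξ hξ
    obtain ⟨p, rfl⟩ := hX ξ (subset_closure (subset_coneGen hξ))
    exact ⟨(Pi.evalAlgHom ℝ (fun _ : X => ℝ) p).comp A.val, fun i => rfl⟩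
  · intro c hc
    obtain ⟨s, u, hu, heq⟩ := isSumOfSquaresFrom_of_nonneg (x := fun p : X => p.1.1) hM₀ hB hC hZ
      hp₀ (U := U) (Submodule.subset_span (mem_insert _ _))
      (fun j k => Submodule.subset_span (mem_insert_of_mem _ ⟨(j, k), rfl⟩))
      fun ξ hξ => sum_mul_nonneg_of_mem_closure_coneGen hc (hK ▸ hξ)
    refine ⟨s, fun i => ⟨u i, hUA (hu i)⟩, hu, hinj ?_⟩
    rw [map_sum, map_sum]
    simp only [map_smul, map_pow]
    refine Eq.trans ?_ heq
    ext p
    simp [coord]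

theorem closure_coneGen_isSpectrahedralShadow_iff
    (n : ℕ) (S : Set (Fin n → ℝ)) (hS : IsSemialgebraic S)
    (C : Set (Fin n → ℝ)) (hC : C = coneGen S) :
    IsSpectrahedralShadow (closure C) ↔
      ∃ (A : Type) (_ : CommRing A) (_ : Algebra ℝ A),
        Algebra.FiniteType ℝ A ∧ IsReduced A ∧
        ∃ (a : Fin n → A) (U : Submodule ℝ A), FiniteDimensional ℝ U ∧
          (∀ ξ ∈ S, ∃ ρ : A →ₐ[ℝ] ℝ, ∀ i, ρ (a i) = ξ i) ∧
          (∀ c : Fin n → ℝ, (∀ ξ ∈ S, 0 ≤ ∑ i, c i * ξ i) →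
            IsSumOfSquaresFrom U (∑ i, c i • a i)) := by
  subst hC
  refine ⟨exists_isSumOfSquaresFrom_of_isSpectrahedralShadow, ?_⟩
  rintro ⟨A, _, _, -, -, a, U, _, hρ, hU⟩
  exact isSpectrahedralShadow_closure_coneGen_of_isSumOfSquaresFrom a U hρ hU
end

section
/- Let S ⊆ ℝ^n be a semialgebraic set, let L ⊆ ℝ[x_1,…,x_n] be a finite-dimensional ℝ-linear subspace with 1 ∉ L, fix a basis g_1, …, g_k of L, and let φ_L : ℝ^n → ℝ^k be given by φ_L(ξ) = (g_1(ξ),…,g_k(ξ)). Set L_1 = ℝ·1 + L. Suppose that for i = 1, …, m there are given a commutative ℝ-algebra A_i, elements a^{(i)}_1, …, a^{(i)}_n ∈ A_i, and a finite-dimensional ℝ-linear subspace U_i ⊆ A_i, such that: (1) for every ξ ∈ S and every i there exists an ℝ-algebra homomorphism ρ : A_i → ℝ with ρ(a^{(i)}_j) = ξ_j for j = 1, …, n; and (2) for every f ∈ L_1 with f(ξ) ≥ 0 for all ξ ∈ S there exists an index i such that the element f(a^{(i)}_1,…,a^{(i)}_n) of A_i (obtained by substituting a^{(i)}_j for x_j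 in f) is a sum of squares of elements of U_i. Then the closed convex hull of φ_L(S) in ℝ^k is a spectrahedral shadow. -/
/-- A commutative `ℝ`-algebra together with `n` distinguished elements and a distinguished
linear subspace. -/
structure AlgebraicData (n : ℕ) where
  carrier : Type
  [commRing : CommRing carrier]
  [alg : Algebra ℝ carrier]
  elem : Fin n → carrier
  U : Submodule ℝ carrier

attribute [instance] AlgebraicData.commRing AlgebraicData.alg

section Spectrahedron

/-- A subset of a real vector space defined by one linear matrix inequality, the matrix entries
being affine functionals. -/
def IsSpectrahedron {Z : Type*} [AddCommGroup Z] [Module ℝ Z] (Q : Set Z) : Prop :=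
  ∃ (ι : Type) (_ : Fintype ι) (M : Matrix ι ι (Z →ᵃ[ℝ] ℝ)), M.IsSymm ∧
    Q = {z | (M.map fun f => f z).PosSemidef}

theorem Matrix.posSemidef_fromBlocks_zero_iff {m n : Type*} [Fintype m] [Fintype n]
    {M : Matrix m m ℝ} {N : Matrix n n ℝ} :
    (Matrix.fromBlocks M 0 0 N).PosSemidef ↔ M.PosSemidef ∧ N.PosSemidef := by
  constructor
  · intro h
    exact ⟨h.submatrix Sum.inl, h.submatrix Sum.inr⟩
  · rintro ⟨hM, hN⟩
    refine .of_dotProduct_mulVec_nonneg (hM.1.fromBlocks (by simp) hN.1) fun x => ?_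
    have h₁ := hM.dotProduct_mulVec_nonneg (x ∘ Sum.inl)
    have h₂ := hN.dotProduct_mulVec_nonneg (x ∘ Sum.inr)
    simpa [Matrix.fromBlocks_mulVec, dotProduct, Fintype.sum_sum_type] using add_nonneg h₁ h₂

variable {Z : Type*} [AddCommGroup Z] [Module ℝ Z]

theorem IsSpectrahedron.inter {P Q : Set Z} (hP : IsSpectrahedron P) (hQ : IsSpectrahedron Q) :
    IsSpectrahedron (P ∩ Q) := by
  obtain ⟨ι, _, M, hM, rfl⟩ := hP
  obtain ⟨κ, _, N, hN, rfl⟩ := hQ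
  refine ⟨ι ⊕ κ, inferInstance, Matrix.fromBlocks M 0 0 N, hM.fromBlocks (by simp) hN, ?_⟩
  ext z
  have h : (Matrix.fromBlocks M 0 0 N).map (fun f => f z) =
      Matrix.fromBlocks (M.map fun f => f z) 0 0 (N.map fun f => f z) := by
    rw [Matrix.fromBlocks_map]
    congr 1
  rw [Set.mem_ofPred_eq, h, Matrix.posSemidef_fromBlocks_zero_iff]
  rfl

theorem IsSpectrahedron.univ : IsSpectrahedron (Set.univ : Set Z) :=
  ⟨Empty, inferInstance, 0, Matrix.isSymm_zero, by
    ext z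
    simpa using Matrix.PosSemidef.zero⟩

theorem IsSpectrahedron.iInter {κ : Type*} [Finite κ] {Q : κ → Set Z}
    (hQ : ∀ i, IsSpectrahedron (Q i)) : IsSpectrahedron (⋂ i, Q i) := by
  classical
  have := Fintype.ofFinite κ
  have h (s : Finset κ) : IsSpectrahedron (⋂ i ∈ s, Q i) := by
    induction s using Finset.induction_on with
    | empty => simpa using IsSpectrahedron.univ
    | insert a s _ ih =>
      rw [Finset.set_biInter_insert]
      exact (hQ a).inter ih
  simpa using h Finset.univ

theorem isSpectrahedron_setOf_nonneg (f : Z →ᵃ[ℝ] ℝ) : IsSpectrahedron {z | 0 ≤ f z} := by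
  refine ⟨Unit, inferInstance, fun _ _ => f, Matrix.IsSymm.ext fun _ _ => rfl, ?_⟩
  ext z
  have h : (Matrix.map (fun _ _ => f : Matrix Unit Unit (Z →ᵃ[ℝ] ℝ)) fun f => f z) =
      Matrix.diagonal fun _ => f z := by
    ext i j
    exact (Matrix.diagonal_apply_eq (fun _ => f z) i).symm
  rw [Set.mem_ofPred_eq, Set.mem_ofPred_eq, h, Matrix.posSemidef_diagonal_iff]
  simp

theorem isSpectrahedron_setOf_eq_zero (f : Z →ᵃ[ℝ] ℝ) : IsSpectrahedron {z | f z = 0} := by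
  have h : {z | f z = 0} = {z | 0 ≤ f z} ∩ {z | 0 ≤ (-f) z} := by
    ext z
    simp [le_antisymm_iff, and_comm]
  rw [h]
  exact (isSpectrahedron_setOf_nonneg f).inter (isSpectrahedron_setOf_nonneg (-f))

theorem isSpectrahedron_setOf_bilinForm_nonneg {W : Type} [AddCommGroup W] [Module ℝ W]
    [FiniteDimensional ℝ W] (β : W →ₗ[ℝ] W →ₗ[ℝ] Z →ₗ[ℝ] ℝ) (hβ : ∀ v w, β v w = β w v) :
    IsSpectrahedron {z | ∀ w, 0 ≤ β w w z} := by
  let b := Module.finBasis ℝ W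
  refine ⟨Fin (Module.finrank ℝ W), inferInstance,
    Matrix.of fun i j => (β (b i) (b j)).toAffineMap,
    Matrix.IsSymm.ext fun i j => by simp [hβ (b i) (b j)], ?_⟩
  ext z
  have key (x : Fin (Module.finrank ℝ W) → ℝ) :
      star x ⬝ᵥ (((Matrix.of fun i j => (β (b i) (b j)).toAffineMap).map fun f => f z).mulVec x) =
        β (b.equivFun.symm x) (b.equivFun.symm x) z := by
    simp only [Module.Basis.equivFun_symm_apply, map_sum, map_smul, LinearMap.sum_apply,
      LinearMap.smul_apply, dotProduct, Matrix.mulVec, Finset.mul_sum, Finset.smul_sum]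
    rw [Finset.sum_comm]
    refine Finset.sum_congr rfl fun i _ => Finset.sum_congr rfl fun j _ => ?_
    simp
    ring
  rw [Set.mem_ofPred_eq, Set.mem_ofPred_eq, Matrix.posSemidef_iff_dotProduct_mulVec]
  refine ⟨fun h => ⟨?_, fun x => ?_⟩, fun h w => ?_⟩
  · ext i j
    simp [hβ (b i) (b j)]
  · rw [key]
    exact h _
  · have := h.2 (b.equivFun w)
    rwa [key, LinearEquiv.symm_apply_apply] at this

theorem IsSpectrahedron.preimage {Z' : Type*} [AddCommGroup Z'] [Module ℝ Z'] {Q : Set Z}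
    (hQ : IsSpectrahedron Q) (f : Z' →ᵃ[ℝ] Z) : IsSpectrahedron (f ⁻¹' Q) := by
  obtain ⟨ι, _, M, hM, rfl⟩ := hQ
  exact ⟨ι, inferInstance, M.map fun g => g.comp f, hM.map _, rfl⟩

theorem IsSpectrahedron.isSpectrahedralShadow {k : ℕ} {Y : Type*} [AddCommGroup Y] [Module ℝ Y]
    [FiniteDimensional ℝ Y] {Q : Set ((Fin k → ℝ) × Y)} (hQ : IsSpectrahedron Q) :
    IsSpectrahedralShadow {ξ | ∃ y, (ξ, y) ∈ Q} := by
  classical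
  obtain ⟨ι, _, M, hM, hQ⟩ :
      ∃ (ι : Type) (_ : Fintype ι) (M : Matrix (Option ι) (Option ι) ((Fin k → ℝ) × Y →ᵃ[ℝ] ℝ)),
        M.IsSymm ∧ Q = {z | (M.map fun f => f z).PosSemidef} := by
    obtain ⟨ι, _, M, hM, rfl⟩ := hQ
    refine ⟨ι, inferInstance, (Matrix.fromBlocks M 0 0 (0 : Matrix Unit Unit _)).submatrix
      (Equiv.optionEquivSumPUnit ι) (Equiv.optionEquivSumPUnit ι),
      (hM.fromBlocks (by simp) Matrix.isSymm_zero).submatrix _, ?_⟩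
    ext z
    have h : (Matrix.fromBlocks M 0 0 (0 : Matrix Unit Unit _)).map (fun f => f z) =
        Matrix.fromBlocks (M.map fun f => f z) 0 0 0 := by
      rw [Matrix.fromBlocks_map]
      congr 1
    rw [Set.mem_ofPred_eq, Set.mem_ofPred_eq, ← Matrix.submatrix_map,
      Matrix.posSemidef_submatrix_equiv, h, Matrix.posSemidef_fromBlocks_zero_iff]
    simp [Matrix.PosSemidef.zero]
  let e := (Fintype.equivFin (Option ι)).symm
  let b := Module.finBasis ℝ Y
  refine ⟨Fintype.card (Option ι), Module.finrank ℝ Y, Fintype.card_pos,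
    Matrix.of fun i j => M (e i) (e j) 0,
    fun l => Matrix.of fun i j => (M (e i) (e j)).linear (Pi.single l 1, 0),
    fun l => Matrix.of fun i j => (M (e i) (e j)).linear (0, b l),
    Matrix.IsSymm.ext fun i j => by simp [hM.apply (e i) (e j)],
    fun l => Matrix.IsSymm.ext fun i j => by simp [hM.apply (e i) (e j)],
    fun l => Matrix.IsSymm.ext fun i j => by simp [hM.apply (e i) (e j)], ?_⟩
  ext ξ
  rw [Set.mem_ofPred_eq, Set.mem_ofPred_eq, ← b.equivFun.symm.surjective.exists.symm]
  refine exists_congr fun η => ?_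
  rw [hQ, Set.mem_ofPred_eq, ← Matrix.posSemidef_submatrix_equiv e]
  refine iff_of_eq (congrArg _ ?_)
  ext i j
  have hξ : (ξ, b.equivFun.symm η) =
      ∑ l, ξ l • ((Pi.single l 1, 0) : (Fin k → ℝ) × Y) + ∑ l, η l • ((0, b l) : _ × Y) := by
    refine Prod.ext ?_ ?_
    · simp [Prod.fst_sum, ← pi_eq_sum_univ']
    · simp [Prod.snd_sum, Module.Basis.equivFun_symm_apply]
  have hf (f : (Fin k → ℝ) × Y →ᵃ[ℝ] ℝ) (z) : f z = f 0 + f.linear z := by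
    rw [AffineMap.decomp' f]
    simp
  simp only [Matrix.submatrix_apply, Matrix.map_apply, Matrix.add_apply, Matrix.sum_apply,
    Matrix.smul_apply, Matrix.of_apply]
  rw [hf _ (ξ, _), hξ, map_add, map_sum, map_sum]
  simp only [map_smul, add_assoc]

end Spectrahedron

section SumOfSquares

variable {A : Type*} [CommRing A] [Algebra ℝ A]

/-- The convex cone of sums of squares of elements of `U`. -/
noncomputable def sosCone (U : Submodule ℝ A) : PointedCone ℝ A :=
  Submodule.span {c : ℝ // 0 ≤ c} ((· ^ 2) '' (U : Set A))

theorem sq_mem_sosCone {U : Submodule ℝ A} {u : A} (hu : u ∈ U) : u ^ 2 ∈ sosCone U :=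
  Submodule.subset_span ⟨u, hu, rfl⟩

theorem smul_mem_sosCone {U : Submodule ℝ A} {c : ℝ} (hc : 0 ≤ c) {x : A} (hx : x ∈ sosCone U) :
    c • x ∈ sosCone U :=
  PointedCone.smul_mem _ hc hx

theorem mem_sosCone_iff {U : Submodule ℝ A} {x : A} :
    x ∈ sosCone U ↔ IsSumOfSquaresFrom U x := by
  constructor
  · intro hx
    induction hx using Submodule.span_induction with
    | mem x hx =>
      obtain ⟨u, hu, rfl⟩ := hx
      exact ⟨1, fun _ => u, fun _ => hu, by simp⟩
    | zero => exact ⟨0, Fin.elim0, fun i => i.elim0, by simp⟩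
    | add x y _ _ hx hy =>
      obtain ⟨s, u, hu, rfl⟩ := hx
      obtain ⟨t, v, hv, rfl⟩ := hy
      refine ⟨s + t, Fin.append u v, fun i => ?_, by simp [Fin.sum_univ_add]⟩
      induction i using Fin.addCases <;> simp [hu, hv]
    | smul c x _ hx =>
      obtain ⟨s, u, hu, rfl⟩ := hx
      refine ⟨s, fun i => √(c : ℝ) • u i, fun i => U.smul_mem _ (hu i), ?_⟩
      simp only [smul_pow, Real.sq_sqrt c.2, Finset.smul_sum]
      rfl
  · rintro ⟨s, u, hu, rfl⟩
    exact sum_mem fun i _ => sq_mem_sosCone (hu i)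

/-- The elements of `U` whose square is dominated, modulo sums of squares from `U`, by an element
of `H`. -/
def dominatedSubmodule (H U : Submodule ℝ A) : Submodule ℝ A where
  carrier := {u | u ∈ U ∧ ∃ x ∈ H, x - u ^ 2 ∈ sosCone U}
  zero_mem' := ⟨U.zero_mem, 0, H.zero_mem, by simp⟩
  add_mem' := by
    rintro u v ⟨hu, x, hx, hxu⟩ ⟨hv, y, hy, hyv⟩
    refine ⟨U.add_mem hu hv, (2 : ℝ) • (x + y), H.smul_mem _ (H.add_mem hx hy), ?_⟩
    have h : (2 : ℝ) • (x + y) - (u + v) ^ 2 =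
        (2 : ℝ) • ((x - u ^ 2) + (y - v ^ 2)) + (u - v) ^ 2 := by
      simp only [two_smul]
      ring
    rw [h]
    exact add_mem (smul_mem_sosCone zero_le_two (add_mem hxu hyv))
      (sq_mem_sosCone (U.sub_mem hu hv))
  smul_mem' := by
    rintro c u ⟨hu, x, hx, hxu⟩
    refine ⟨U.smul_mem _ hu, c ^ 2 • x, H.smul_mem _ hx, ?_⟩
    rw [smul_pow, ← smul_sub]
    exact smul_mem_sosCone (sq_nonneg c) hxu

theorem dominatedSubmodule_le (H U : Submodule ℝ A) : dominatedSubmodule H U ≤ U :=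
  fun _ hu => hu.1

theorem mem_sosCone_dominatedSubmodule {H U : Submodule ℝ A} {a b : A} (ha : a ∈ sosCone U)
    (hb : b ∈ sosCone U) (hab : a + b ∈ H) : a ∈ sosCone (dominatedSubmodule H U) := by
  obtain ⟨s, u, hu, rfl⟩ := mem_sosCone_iff.1 ha
  refine sum_mem fun i _ => sq_mem_sosCone ⟨hu i, _, hab, ?_⟩
  rw [← Finset.add_sum_erase _ _ (Finset.mem_univ i), add_assoc, add_sub_cancel_left]
  exact add_mem (sum_mem fun j _ => sq_mem_sosCone (hu j)) hb

theorem exists_sub_sq_mem_sosCone_dominatedSubmodule {H U : Submodule ℝ A} {u : A}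
    (hu : u ∈ dominatedSubmodule H U) :
    ∃ x ∈ H, x - u ^ 2 ∈ sosCone (dominatedSubmodule H U) := by
  obtain ⟨hU, x, hx, hxu⟩ := hu
  exact ⟨x, hx, mem_sosCone_dominatedSubmodule hxu (sq_mem_sosCone hU) (by simpa using hx)⟩

theorem exists_add_mem_sosCone_dominatedSubmodule {H U : Submodule ℝ A} {y : A}
    (hy : y ∈ dominatedSubmodule H U * dominatedSubmodule H U ⊔ H) :
    ∃ x ∈ H, x + y ∈ sosCone (dominatedSubmodule H U) := by
  obtain ⟨p, hp, z, hz, rfl⟩ := Submodule.mem_sup.1 hy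
  clear hy
  suffices h : ∃ x ∈ H, x + p ∈ sosCone (dominatedSubmodule H U) by
    obtain ⟨x, hx, hxp⟩ := h
    exact ⟨x - z, H.sub_mem hx hz, by convert hxp using 1; ring⟩
  induction hp using Submodule.mul_induction_on' with
  | mem_mul_mem u hu v hv =>
    obtain ⟨x, hx, hxu⟩ := exists_sub_sq_mem_sosCone_dominatedSubmodule (sub_mem hu hv)
    refine ⟨(1 / 4 : ℝ) • x, H.smul_mem _ hx, ?_⟩
    have h : (1 / 4 : ℝ) • x + u * v =
        (1 / 4 : ℝ) • ((x - (u - v) ^ 2) + (u + v) ^ 2) := by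
      have h4 : x - (u - v) ^ 2 + (u + v) ^ 2 = x + (4 : ℝ) • (u * v) := by
        rw [ofNat_smul_eq_nsmul, nsmul_eq_mul]
        push_cast
        ring
      rw [h4, smul_add, smul_smul]
      norm_num
    rw [h]
    exact smul_mem_sosCone (by norm_num) (add_mem hxu (sq_mem_sosCone (add_mem hu hv)))
  | add p _ q _ hp hq =>
    obtain ⟨x, hx, hxp⟩ := hp
    obtain ⟨y, hy, hyq⟩ := hq
    exact ⟨x + y, H.add_mem hx hy, by convert add_mem hxp hyq using 1; ring⟩

theorem exists_linearMap_nonneg_on_squares {T : Type*} [AddCommGroup T] [Module ℝ T]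
    (h : T →ₗ[ℝ] A) (U : Submodule ℝ A) (lam : T →ₗ[ℝ] ℝ)
    (hlam : ∀ t, h t ∈ sosCone U → 0 ≤ lam t) :
    let V := dominatedSubmodule (LinearMap.range h) U
    let X := V * V ⊔ LinearMap.range h
    ∃ μ : X →ₗ[ℝ] ℝ, (∀ t (ht : h t ∈ X), μ ⟨h t, ht⟩ = lam t) ∧
      ∀ (v : V) (hv : (v : A) * v ∈ X), 0 ≤ μ ⟨v * v, hv⟩ := by
  intro V X
  obtain ⟨ν, hν⟩ : lam ∈ LinearMap.range h.dualMap := by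
    rw [LinearMap.range_dualMap_eq_dualAnnihilator_ker, Submodule.mem_dualAnnihilator]
    intro t ht
    rw [LinearMap.mem_ker] at ht
    have h₁ := hlam t (by simp [ht])
    have h₂ := hlam (-t) (by simp [ht])
    rw [map_neg] at h₂
    linarith
  have hν' (t : T) : ν (h t) = lam t := by rw [← hν]; rfl
  obtain ⟨μ, hμ, hμ'⟩ := riesz_extension ((sosCone V).comap X.subtype)
    ⟨(LinearMap.range h).comap X.subtype, ν ∘ₗ X.subtype ∘ₗ Submodule.subtype _⟩
    (by
      rintro ⟨⟨x, hx⟩, t, ht⟩ hs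
      obtain rfl : h t = x := ht
      change 0 ≤ ν (h t)
      rw [hν']
      exact hlam t (Submodule.span_mono
        (Set.image_mono (dominatedSubmodule_le _ _)) hs))
    (by
      rintro ⟨y, hy⟩
      obtain ⟨x, hx, hxy⟩ := exists_add_mem_sosCone_dominatedSubmodule hy
      exact ⟨⟨⟨x, Submodule.mem_sup_right hx⟩, hx⟩, hxy⟩)
  refine ⟨μ, fun t ht => ?_, fun v hv => hμ' _ ?_⟩
  · rw [← hν']
    exact hμ ⟨⟨h t, ht⟩, t, rfl⟩
  · change (v : A) * v ∈ sosCone V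
    rw [← sq]
    exact sq_mem_sosCone v.2

/-- The multiplication map of a subspace, with values in a subspace containing its products. -/
def Submodule.mulRestrict (V X : Submodule ℝ A) (hVX : V * V ≤ X) : V →ₗ[ℝ] V →ₗ[ℝ] X :=
  LinearMap.mk₂ ℝ (fun v w => ⟨v * w, hVX (Submodule.mul_mem_mul v.2 w.2)⟩)
    (fun _ _ _ => Subtype.ext (add_mul _ _ _)) (fun _ _ _ => Subtype.ext (smul_mul_assoc _ _ _))
    (fun _ _ _ => Subtype.ext (mul_add _ _ _)) (fun _ _ _ => Subtype.ext (mul_smul_comm _ _ _))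

end SumOfSquares

/-- The functionals that are nonnegative on the preimage of a cone of sums of squares form the
projection of a spectrahedron. -/
theorem exists_isSpectrahedron_nonneg_on_sos {A : Type} [CommRing A] [Algebra ℝ A] {T : Type}
    [AddCommGroup T] [Module ℝ T] [FiniteDimensional ℝ T] (h : T →ₗ[ℝ] A) (U : Submodule ℝ A)
    [FiniteDimensional ℝ U] :
    ∃ (Y : Type) (_ : AddCommGroup Y) (_ : Module ℝ Y) (_ : FiniteDimensional ℝ Y)
      (Q : Set (Module.Dual ℝ T × Y)), IsSpectrahedron Q ∧
      ∀ lam : Module.Dual ℝ T, (∃ y, (lam, y) ∈ Q) ↔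
        ∀ t, IsSumOfSquaresFrom U (h t) → 0 ≤ lam t := by
  let V := dominatedSubmodule (LinearMap.range h) U
  let X := V * V ⊔ LinearMap.range h
  have : FiniteDimensional ℝ V := Submodule.finiteDimensional_of_le (dominatedSubmodule_le _ U)
  have hX : X.FG := by
    have hV : V.FG := Module.Finite.iff_fg.1 this
    exact (hV.mul hV).sup (Module.Finite.iff_fg.1 inferInstance)
  have : FiniteDimensional ℝ X := Module.Finite.iff_fg.2 hX
  have hhX (t : T) : h t ∈ X := Submodule.mem_sup_right ⟨t, rfl⟩
  let b := Module.finBasis ℝ T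
  let j : T →ₗ[ℝ] X := h.codRestrict X hhX
  let f (l : Fin (Module.finrank ℝ T)) : Module.Dual ℝ T × Module.Dual ℝ X →ₗ[ℝ] ℝ :=
    Module.Dual.eval ℝ X (j (b l)) ∘ₗ LinearMap.snd ℝ _ _ -
      Module.Dual.eval ℝ T (b l) ∘ₗ LinearMap.fst ℝ _ _
  let β : V →ₗ[ℝ] V →ₗ[ℝ] Module.Dual ℝ T × Module.Dual ℝ X →ₗ[ℝ] ℝ :=
    (V.mulRestrict X le_sup_left).compr₂
      ((LinearMap.lcomp ℝ ℝ (LinearMap.snd ℝ _ _)) ∘ₗ Module.Dual.eval ℝ X)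
  refine ⟨Module.Dual ℝ X, inferInstance, inferInstance, inferInstance,
    {z | ∀ v, 0 ≤ β v v z} ∩ ⋂ l, {z | (f l).toAffineMap z = 0},
    (isSpectrahedron_setOf_bilinForm_nonneg β fun v w => ?_).inter
      (.iInter fun l => isSpectrahedron_setOf_eq_zero _), fun lam => ⟨?_, fun hlam => ?_⟩⟩
  · have : V.mulRestrict X le_sup_left v w = V.mulRestrict X le_sup_left w v :=
      Subtype.ext (mul_comm _ _)
    simp [β, this]
  · rintro ⟨μ, hμ, hμ'⟩ t ht
    have hj : μ ∘ₗ j = lam := b.ext fun l => sub_eq_zero.1 (Set.mem_iInter.1 hμ' l)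
    rw [← mem_sosCone_iff] at ht
    obtain ⟨s, u, hu, hs⟩ := mem_sosCone_iff.1
      (mem_sosCone_dominatedSubmodule ht (zero_mem _) (by simp : h t + 0 ∈ LinearMap.range h))
    have hjt : j t = ∑ i, V.mulRestrict X le_sup_left ⟨u i, hu i⟩ ⟨u i, hu i⟩ := by
      refine Subtype.ext ?_
      rw [AddSubmonoidClass.coe_finsetSum]
      exact hs.trans (Finset.sum_congr rfl fun i _ => sq _)
    rw [← hj, LinearMap.comp_apply, hjt, map_sum]
    exact Finset.sum_nonneg fun i _ => hμ ⟨u i, hu i⟩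
  · obtain ⟨μ, hμ, hμ'⟩ := exists_linearMap_nonneg_on_squares h U lam
      fun t ht => hlam t (mem_sosCone_iff.1 ht)
    refine ⟨μ, fun v => hμ' v _, Set.mem_iInter.2 fun l => ?_⟩
    exact sub_eq_zero.2 (hμ (b l) (hhX _))

theorem mem_closure_convexHull_image_iff {n k : ℕ} (S : Set (Fin n → ℝ))
    (φ : (Fin n → ℝ) → Fin k → ℝ) (x : Fin k → ℝ) :
    x ∈ closure (convexHull ℝ (φ '' S)) ↔
      ∀ (c : ℝ) (v : Fin k → ℝ), (∀ ξ ∈ S, 0 ≤ c + v ⬝ᵥ φ ξ) → 0 ≤ c + v ⬝ᵥ x := by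
  constructor
  · intro hx c v hcv
    have hclosed : IsClosed {y : Fin k → ℝ | 0 ≤ c + v ⬝ᵥ y} :=
      isClosed_le continuous_const (by unfold dotProduct; fun_prop)
    have hconvex : Convex ℝ {y : Fin k → ℝ | 0 ≤ c + v ⬝ᵥ y} := by
      intro y hy z hz a b ha hb hab
      simp only [Set.mem_ofPred_eq, dotProduct_add, dotProduct_smul, smul_eq_mul] at *
      nlinarith [mul_nonneg ha hy, mul_nonneg hb hz, congrArg (c * ·) hab]
    refine closure_minimal (convexHull_min ?_ hconvex) hclosed hx
    rintro _ ⟨ξ, hξ, rfl⟩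
    exact hcv ξ hξ
  · intro h
    by_contra hx
    obtain ⟨f, u, hu, hux⟩ :=
      geometric_hahn_banach_closed_point (convex_convexHull ℝ (φ '' S)).closure isClosed_closure hx
    have hf (y : Fin k → ℝ) : f y = (fun i => f (Pi.single i 1)) ⬝ᵥ y := by
      conv_lhs => rw [pi_eq_sum_univ' y]
      simp only [map_sum, map_smul, dotProduct, smul_eq_mul]
      refine Finset.sum_congr rfl fun i _ => ?_
      rw [mul_comm]
    have := h u (-fun i => f (Pi.single i 1)) fun ξ hξ => by
      have := hu _ (subset_closure (subset_convexHull ℝ _ ⟨ξ, hξ, rfl⟩))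
      rw [neg_dotProduct, ← hf]
      linarith
    rw [neg_dotProduct, ← hf] at this
    linarith

theorem isSpectrahedralShadow_closure_convexHull_of_sos
    (n : ℕ) (S : Set (Fin n → ℝ)) (hS : IsSemialgebraic S)
    (L : Submodule ℝ (MvPolynomial (Fin n) ℝ)) (hL : FiniteDimensional ℝ L)
    (h1 : (1 : MvPolynomial (Fin n) ℝ) ∉ L)
    (k : ℕ) (g : Fin k → MvPolynomial (Fin n) ℝ)
    (hgL : ∀ i, g i ∈ L) (hspan : Submodule.span ℝ (Set.range g) = L)
    (hind : LinearIndependent ℝ g)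
    (m : ℕ) (D : Fin m → AlgebraicData n)
    (hU : ∀ i, FiniteDimensional ℝ (D i).U)
    (hpoint : ∀ ξ ∈ S, ∀ i, ∃ ρ : (D i).carrier →ₐ[ℝ] ℝ, ∀ j, ρ ((D i).elem j) = ξ j)
    (hsos : ∀ f ∈ Submodule.span ℝ {(1 : MvPolynomial (Fin n) ℝ)} ⊔ L,
      (∀ ξ ∈ S, 0 ≤ MvPolynomial.eval ξ f) →
      ∃ i, IsSumOfSquaresFrom (D i).U (MvPolynomial.aeval (D i).elem f)) :
    IsSpectrahedralShadow
      (closure (convexHull ℝ ((fun ξ => fun i => MvPolynomial.eval ξ (g i)) '' S))) := by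
  classical
  let poly : (ℝ × (Fin k → ℝ)) →ₗ[ℝ] MvPolynomial (Fin n) ℝ :=
    (LinearMap.toSpanSingleton ℝ _ 1).coprod (Fintype.linearCombination ℝ g)
  have poly_mem (t : ℝ × (Fin k → ℝ)) : poly t ∈ Submodule.span ℝ {(1 : MvPolynomial (Fin n) ℝ)} ⊔ L := by
    refine Submodule.add_mem_sup ?_ ?_
    · exact Submodule.smul_mem _ _ (Submodule.mem_span_singleton_self 1)
    · rw [LinearMap.comp_apply, Fintype.linearCombination_apply]
      exact Submodule.sum_mem _ fun i _ => L.smul_mem _ (hgL i)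
  have eval_poly (t : ℝ × (Fin k → ℝ)) (ξ : Fin n → ℝ) : MvPolynomial.eval ξ (poly t) =
      t.1 + t.2 ⬝ᵥ fun i => MvPolynomial.eval ξ (g i) := by
    simp [poly, Fintype.linearCombination_apply, dotProduct, MvPolynomial.smul_eval]
  choose Y instGroup instModule instFinite Q hQ hQ' using fun i =>
    have := hU i
    exists_isSpectrahedron_nonneg_on_sos
      ((MvPolynomial.aeval (D i).elem).toLinearMap ∘ₗ poly) (D i).U
  let functional : (Fin k → ℝ) →ᵃ[ℝ] Module.Dual ℝ (ℝ × (Fin k → ℝ)) :=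
    AffineMap.const ℝ _ (LinearMap.fst ℝ ℝ (Fin k → ℝ)) +
      ((LinearMap.lcomp ℝ ℝ (LinearMap.snd ℝ ℝ (Fin k → ℝ))) ∘ₗ
        dotProductBilin ℝ ℝ).toAffineMap
  have functional_apply (x : Fin k → ℝ) (t : ℝ × (Fin k → ℝ)) : functional x t = t.1 + t.2 ⬝ᵥ x := by
    simp [functional, dotProduct_comm x]
  let proj (i : Fin m) : (Fin k → ℝ) × (∀ i, Y i) →ᵃ[ℝ] Module.Dual ℝ (ℝ × (Fin k → ℝ)) × Y i :=
    functional.prodMap (LinearMap.proj i).toAffineMap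
  have hspec : IsSpectrahedron (⋂ i, proj i ⁻¹' Q i) :=
    .iInter fun i => (hQ i).preimage (proj i)
  convert hspec.isSpectrahedralShadow using 1
  ext x
  have hx : x ∈ {ξ | ∃ y, (ξ, y) ∈ ⋂ i, proj i ⁻¹' Q i} ↔
      ∀ i, ∃ y, (functional x, y) ∈ Q i := by
    simp only [Set.mem_ofPred_eq, Set.mem_iInter]
    exact (Classical.skolem (p := fun i y => (functional x, y) ∈ Q i)).symm
  rw [mem_closure_convexHull_image_iff, hx]
  constructor
  · intro h i
    rw [hQ']
    rintro t ⟨s, u, -, hu⟩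
    rw [functional_apply]
    refine h t.1 t.2 fun ξ hξ => ?_
    obtain ⟨ρ, hρ⟩ := hpoint ξ hξ i
    have hcomp : ρ (MvPolynomial.aeval (D i).elem (poly t)) = MvPolynomial.eval ξ (poly t) := by
      simp only [MvPolynomial.comp_aeval_apply, hρ]
      exact DFunLike.congr_fun (MvPolynomial.coe_aeval_eq_eval ξ) _
    rw [← eval_poly, ← hcomp]
    have hu' : MvPolynomial.aeval (D i).elem (poly t) = ∑ i, u i ^ 2 := hu
    rw [hu', map_sum]
    exact Finset.sum_nonneg fun j _ => by rw [map_pow]; positivity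
  · intro h c v hcv
    obtain ⟨i, hi⟩ := hsos _ (poly_mem (c, v)) fun ξ hξ => by
      rw [eval_poly]
      exact hcv ξ hξ
    rw [← functional_apply x (c, v)]
    exact (hQ' i _).1 (h i) (c, v) hi
end

section
/- Let M_1, …, M_n be real symmetric d×d matrices, write M(ξ) = ξ_1M_1 + … + ξ_nM_n for ξ ∈ ℝ^n, and let C = {ξ ∈ ℝ^n : M(ξ) is positive semidefinite}. Assume there exists ξ⁰ ∈ ℝ^n such that M(ξ⁰) is positive definite. Then the dual cone C* = {y ∈ ℝ^n : y_1ξ_1 + … + y_nξ_n ≥ 0 for all ξ ∈ C} equals {(tr(BM_1), …, tr(BM_n)) : B a real symmetric positive semidefinite d×d matrix}. -/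
open Matrix in
/-- The cone of (not necessarily symmetric) real matrices whose quadratic form is nonnegative. -/
def nonnegFormCone (ι : Type*) [Fintype ι] : PointedCone ℝ (Matrix ι ι ℝ) where
  carrier := {A | ∀ x : ι → ℝ, 0 ≤ x ⬝ᵥ A *ᵥ x}
  add_mem' {A B} hA hB x := by
    rw [add_mulVec, dotProduct_add]
    exact add_nonneg (hA x) (hB x)
  zero_mem' x := by simp
  smul_mem' c A hA x := by
    change 0 ≤ x ⬝ᵥ ((c : ℝ) • A) *ᵥ x
    rw [smul_mulVec, dotProduct_smul, smul_eq_mul]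
    exact mul_nonneg c.2 (hA x)

open Matrix in
theorem mem_nonnegFormCone {ι : Type*} [Fintype ι] {A : Matrix ι ι ℝ} :
    A ∈ nonnegFormCone ι ↔ ∀ x : ι → ℝ, 0 ≤ x ⬝ᵥ A *ᵥ x := Iff.rfl

open scoped MatrixOrder Matrix in
theorem Matrix.PosSemidef.trace_mul_nonneg {ι : Type*} [Fintype ι] {A B : Matrix ι ι ℝ}
    (hA : A.PosSemidef) (hB : B.PosSemidef) : 0 ≤ (A * B).trace := by
  classical
  obtain ⟨K, rfl⟩ := CStarAlgebra.nonneg_iff_eq_star_mul_self.mp hA.nonneg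
  rw [mul_assoc, Matrix.trace_mul_comm]
  exact (hB.mul_mul_conjTranspose_same K).trace_nonneg

open Matrix in
theorem Matrix.PosDef.exists_smul_add_mem_nonnegFormCone {ι : Type*} [Fintype ι]
    {P : Matrix ι ι ℝ} (hP : P.PosDef) (A : Matrix ι ι ℝ) :
    ∃ t : ℝ, t • P + A ∈ nonnegFormCone ι := by
  have hpos {x : ι → ℝ} (hx : x ≠ 0) : 0 < x ⬝ᵥ P *ᵥ x := by
    simpa using hP.dotProduct_mulVec_pos hx
  have hcont (Q : Matrix ι ι ℝ) : Continuous fun x : ι → ℝ => x ⬝ᵥ Q *ᵥ x := by fun_prop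
  obtain ⟨m, hm⟩ := (isCompact_sphere (0 : ι → ℝ) 1).bddBelow_image
    (f := fun x => (x ⬝ᵥ A *ᵥ x) / (x ⬝ᵥ P *ᵥ x))
    ((hcont A).continuousOn.div (hcont P).continuousOn fun x hx =>
      (hpos (ne_zero_of_mem_unit_sphere ⟨x, hx⟩)).ne')
  refine ⟨-m, fun x => ?_⟩
  rcases eq_or_ne x 0 with rfl | hx
  · simp
  have hmx := hm (Set.mem_image_of_mem _ (show ‖x‖⁻¹ • x ∈ Metric.sphere (0 : ι → ℝ) 1 by
    simp [norm_smul, hx]))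
  have hn : ‖x‖ ≠ 0 := norm_ne_zero_iff.mpr hx
  simp only [mulVec_smul, smul_dotProduct, dotProduct_smul, smul_eq_mul] at hmx
  rw [mul_div_mul_left _ _ (inv_ne_zero hn), mul_div_mul_left _ _ (inv_ne_zero hn),
    le_div_iff₀ (hpos hx)] at hmx
  simp only [add_mulVec, smul_mulVec, dotProduct_add, dotProduct_smul, smul_eq_mul]
  linarith

open Matrix in
/-- A functional nonnegative on `nonnegFormCone` vanishes on antisymmetric matrices, so it is
represented by a positive semidefinite matrix. -/
theorem exists_posSemidef_trace_mul_eq {ι : Type*} [Fintype ι] (g : Matrix ι ι ℝ →ₗ[ℝ] ℝ)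
    (hg : ∀ A ∈ nonnegFormCone ι, 0 ≤ g A) :
    ∃ B : Matrix ι ι ℝ, B.PosSemidef ∧ ∀ A, g A = (B * A).trace := by
  classical
  let B : Matrix ι ι ℝ := Matrix.of fun i j => g (single j i 1)
  have hrep (A : Matrix ι ι ℝ) : g A = (B * A).trace := by
    suffices h : g = (traceLinearMap ι ℝ ℝ).comp (LinearMap.mulLeft ℝ B) from
      congrArg (· A) h
    refine ext_linearMap ℝ fun i j => LinearMap.ext_ring ?_
    simp [B, trace_mul_single]
  have hsymm (i j : ι) : g (single i j 1) = g (single j i 1) := by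
    have key (i j : ι) : 0 ≤ g (single i j 1 - single j i 1) := hg _ fun x => by
      have hform (k l : ι) : x ⬝ᵥ single k l (1 : ℝ) *ᵥ x = x k * x l := by
        rw [single_mulVec, one_mul]
        exact dotProduct_single _ _ _
      simp [sub_mulVec, dotProduct_sub, hform, mul_comm]
    have h₁ := key i j
    have h₂ := key j i
    rw [map_sub] at h₁ h₂
    linarith
  refine ⟨B, .of_dotProduct_mulVec_nonneg ?_ fun x => ?_, hrep⟩
  · ext i j
    simp [B, hsymm i j]
  · have h := hg (vecMulVec x x) fun z => by
      rw [vecMulVec_mulVec, dotProduct_comm x z]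
      simpa using mul_self_nonneg (z ⬝ᵥ x)
    rwa [hrep, mul_vecMulVec, trace_vecMulVec, dotProduct_comm] at h


theorem dualCone_spectrahedralCone_eq
    (n d : ℕ) (hd : 0 < d) (M : Fin n → Matrix (Fin d) (Fin d) ℝ)
    (hsym : ∀ i, (M i).IsSymm)
    (C : Set (Fin n → ℝ)) (hC : C = {ξ : Fin n → ℝ | (∑ i, ξ i • M i).PosSemidef})
    (ξ₀ : Fin n → ℝ) (h₀ : (∑ i, ξ₀ i • M i).PosDef) :
    {y : Fin n → ℝ | ∀ ξ ∈ C, 0 ≤ ∑ i, y i * ξ i} =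
      {y : Fin n → ℝ | ∃ B : Matrix (Fin d) (Fin d) ℝ, B.PosSemidef ∧
        ∀ i, y i = (B * M i).trace} := by
  subst hC
  ext y
  constructor
  · intro hy
    let L : (Fin n → ℝ) →ₗ[ℝ] Matrix (Fin d) (Fin d) ℝ := Fintype.linearCombination ℝ M
    let Y : (Fin n → ℝ) →ₗ[ℝ] ℝ := Fintype.linearCombination ℝ y
    have hL (ξ) : L ξ = ∑ i, ξ i • M i := rfl
    have hY (ξ) : Y ξ = ∑ i, y i * ξ i := by
      simp [Y, Fintype.linearCombination_apply, mul_comm]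
    have hLsymm (ξ) : (L ξ).IsHermitian := by
      rw [Matrix.IsHermitian, Matrix.conjTranspose_eq_transpose_of_trivial, hL,
        Matrix.transpose_sum]
      simp [fun i => (hsym i).eq]
    have hpos {ξ} (h : L ξ ∈ nonnegFormCone (Fin d)) : 0 ≤ Y ξ :=
      hY ξ ▸ hy ξ (.of_dotProduct_mulVec_nonneg (hLsymm ξ) (by
        simpa only [star_trivial, hL] using mem_nonnegFormCone.mp h))
    have hker : Y ∈ (LinearMap.ker L).dualAnnihilator := by
      rw [Submodule.mem_dualAnnihilator]
      intro ξ hξ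
      have h₁ : 0 ≤ Y ξ := hpos (by rw [LinearMap.mem_ker.mp hξ]; exact zero_mem _)
      have h₂ : 0 ≤ Y (-ξ) := hpos (by
        rw [map_neg, LinearMap.mem_ker.mp hξ, neg_zero]; exact zero_mem _)
      rw [map_neg] at h₂
      linarith
    rw [← LinearMap.range_dualMap_eq_dualAnnihilator_ker] at hker
    obtain ⟨Z, hZ⟩ := hker
    have hZL (ξ) : Z (L ξ) = Y ξ := congrArg (· ξ) hZ
    obtain ⟨g, hgf, hg⟩ := riesz_extension (nonnegFormCone (Fin d)) (Z.toPMap L.range)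
      (by
        rintro ⟨_, ξ, rfl⟩ h
        simpa [LinearMap.toPMap_apply, hZL] using hpos h)
      (fun A => by
        obtain ⟨t, ht⟩ := h₀.exists_smul_add_mem_nonnegFormCone A
        exact ⟨⟨L (t • ξ₀), t • ξ₀, rfl⟩, by
          change L (t • ξ₀) + A ∈ _
          rwa [map_smul, hL]⟩)
    obtain ⟨B, hB, hgB⟩ := exists_posSemidef_trace_mul_eq g hg
    refine ⟨B, hB, fun i => ?_⟩
    have hLi : L (Pi.single i 1) = M i := by simp [L]
    have hYi : Y (Pi.single i 1) = y i := by simp [Y]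
    rw [← hgB, ← hYi, ← hZL, ← hLi]
    exact (hgf ⟨L (Pi.single i 1), _, rfl⟩).symm
  · rintro ⟨B, hB, hy⟩ ξ hξ
    have h := hB.trace_mul_nonneg hξ
    rw [Matrix.mul_sum, Matrix.trace_sum] at h
    simpa [hy, mul_comm] using h
end
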